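/- arXiv:1604.04230 — 2 statements merged into one kernel-verified Lean document; each statement's English description precedes it below -/
import Mathlib

section
/- Fix k ≥ 1 and let X_k = {0,1}^(ℕ^k) with the k commuting shift operators T₁, …, T_k. Let P ⊆ X_k be a Π⁰₁ class with λ(P) > 0. Then every Martin-Löf random Z ∈ X_k is multiply recurrent in P, i.e., there is n ≥ 1 with Z ∈ ⋂_{1≤i≤k} T_i^{-n}(P). -/
open MeasureTheory

/-- `σ` is a prefix of the infinite binary sequence `Z`. -/
def IsPrefixOf (σ : List Bool) (Z : ℕ → Bool) : Prop :=
  ∀ i : ℕ, i < σ.length → σ.getD i false = Z i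

/-- The open subset `⟦S⟧` of Cantor space generated by a set of finite binary strings. -/
def openCl (S : Set (List Bool)) : Set (ℕ → Bool) :=
  {Z | ∃ σ ∈ S, IsPrefixOf σ Z}

/-- A set of finite binary strings is computably enumerable. -/
def CEStrings (S : Set (List Bool)) : Prop :=
  ∃ f : ℕ → Option (List Bool), Computable f ∧ S = {σ | ∃ n, f n = some σ}

/-- `P` is a Π⁰₁ class: the complement of the open set generated by a c.e. set of strings. -/
def Pi01Class (P : Set (ℕ → Bool)) : Prop :=
  ∃ S : Set (List Bool), CEStrings S ∧ P = (openCl S)ᶜ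

/-- The shift operator `T` on Cantor space: `T Z n = Z (n+1)`. -/
def shift (Z : ℕ → Bool) : ℕ → Bool := fun n => Z (n + 1)

/-- `Z` is `k`-recurrent in `P`: for some `n ≥ 1`, `T^{n i} Z ∈ P` for all `1 ≤ i ≤ k`. -/
def KRecurrentIn (k : ℕ) (P : Set (ℕ → Bool)) (Z : ℕ → Bool) : Prop :=
  ∃ n : ℕ, 1 ≤ n ∧ ∀ i : ℕ, 1 ≤ i → i ≤ k → shift^[n * i] Z ∈ P

/-- `Z` is multiply recurrent in `P`: `k`-recurrent in `P` for every `k ≥ 1`. -/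
def MultiplyRecurrentIn (P : Set (ℕ → Bool)) (Z : ℕ → Bool) : Prop :=
  ∀ k : ℕ, 1 ≤ k → KRecurrentIn k P Z

/-- `μ` is the uniform (fair-coin) product measure on Cantor space:
each basic cylinder determined by a string `σ` has measure `2^{-|σ|}`. -/
def IsUniformMeasure (μ : Measure (ℕ → Bool)) : Prop :=
  ∀ σ : List Bool, μ {Z | IsPrefixOf σ Z} = 2⁻¹ ^ σ.length

/-- A uniformly computably enumerable sequence of sets of strings. -/
def UniformlyCE (S : ℕ → Set (List Bool)) : Prop :=
  ∃ f : ℕ → ℕ → Option (List Bool), Computable₂ f ∧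
    ∀ m, S m = {σ | ∃ n, f m n = some σ}

/-- A Martin-Löf test with respect to the measure `μ`. -/
def MLTest (μ : Measure (ℕ → Bool)) (S : ℕ → Set (List Bool)) : Prop :=
  UniformlyCE S ∧ ∀ m, μ (openCl (S m)) ≤ 2⁻¹ ^ m

/-- `Z` is Martin-Löf random w.r.t. `μ`. -/
def MLRandom (μ : Measure (ℕ → Bool)) (Z : ℕ → Bool) : Prop :=
  ∀ S : ℕ → Set (List Bool), MLTest μ S → ∃ m, Z ∉ openCl (S m)

/-- A real is computable if some computable sequence of rationals approximates it
within `2^{-j}`. -/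
def ComputableReal (x : ℝ) : Prop :=
  ∃ q : ℕ → ℚ, Computable q ∧ ∀ j : ℕ, |x - (q j : ℝ)| ≤ 2⁻¹ ^ j

/-- A Schnorr test w.r.t. `μ`: a Martin-Löf test whose levels have uniformly
computable measures. -/
def SchnorrTest (μ : Measure (ℕ → Bool)) (S : ℕ → Set (List Bool)) : Prop :=
  UniformlyCE S ∧ (∀ m, μ (openCl (S m)) ≤ 2⁻¹ ^ m) ∧
    ∃ q : ℕ → ℕ → ℚ, Computable₂ q ∧
      ∀ m j : ℕ, |(μ (openCl (S m))).toReal - (q m j : ℝ)| ≤ 2⁻¹ ^ j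

/-- `Z` is Schnorr random w.r.t. `μ`. -/
def SchnorrRandom (μ : Measure (ℕ → Bool)) (Z : ℕ → Bool) : Prop :=
  ∀ S : ℕ → Set (List Bool), SchnorrTest μ S → ∃ m, Z ∉ openCl (S m)

/-- `Z` is weakly (Kurtz) random w.r.t. `μ`: it belongs to no Π⁰₁ class of measure `0`. -/
def KurtzRandom (μ : Measure (ℕ → Bool)) (Z : ℕ → Bool) : Prop :=
  ∀ P : Set (ℕ → Bool), Pi01Class P → μ P = 0 → Z ∉ P
/-- The `i`-th shift operator on `X_k = {0,1}^(ℕ^k)`: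
`T_i Z (u₁,…,u_k) = Z (u₁,…,u_i + 1,…,u_k)`. -/
def shiftK {k : ℕ} (i : Fin k) (Z : (Fin k → ℕ) → Bool) : (Fin k → ℕ) → Bool :=
  fun u => Z (fun j => if j = i then u j + 1 else u j)

/-- The array of size `n` coded by `(n, l)` (the list `l` records the `n ^ k` values of a
map `{0,…,n-1}^k → {0,1}` in the order given by `finFunctionFinEquiv`) agrees with `Z`
on its domain. -/
def ArrayAgrees {k : ℕ} (n : ℕ) (l : List Bool) (Z : (Fin k → ℕ) → Bool) : Prop :=
  l.length = n ^ k ∧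
    ∀ u : Fin k → Fin n, l.getD (finFunctionFinEquiv u : ℕ) false = Z (fun j => (u j : ℕ))

/-- The open subset `⟦S⟧` of `X_k` generated by a set `S` of coded arrays. -/
def openClK {k : ℕ} (S : Set (ℕ × List Bool)) : Set ((Fin k → ℕ) → Bool) :=
  {Z | ∃ p ∈ S, ArrayAgrees p.1 p.2 Z}

/-- A set of coded arrays is computably enumerable. -/
def CEArrays (S : Set (ℕ × List Bool)) : Prop :=
  ∃ f : ℕ → Option (ℕ × List Bool), Computable f ∧ S = {σ | ∃ n, f n = some σ}

/-- A Π⁰₁ class in `X_k`: the complement of the open set generated by a c.e. set of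
arrays. -/
def Pi01ClassK {k : ℕ} (P : Set ((Fin k → ℕ) → Bool)) : Prop :=
  ∃ S : Set (ℕ × List Bool), CEArrays S ∧ P = (openClK S)ᶜ

/-- `μ` is the uniform (fair-coin) product measure on `X_k`: the cylinder determined by
an array of size `n` has measure `2^{-n^k}`. -/
def IsUniformMeasureK {k : ℕ} (μ : MeasureTheory.Measure ((Fin k → ℕ) → Bool)) : Prop :=
  ∀ (n : ℕ) (l : List Bool), l.length = n ^ k →
    μ {Z | ArrayAgrees n l Z} = 2⁻¹ ^ (n ^ k)

/-- `Z` is multiply recurrent in `P ⊆ X_k`: there is `n ≥ 1` with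
`Z ∈ ⋂_{1 ≤ i ≤ k} T_i^{-n} P`. -/
def MultiplyRecurrentK {k : ℕ} (P : Set ((Fin k → ℕ) → Bool))
    (Z : (Fin k → ℕ) → Bool) : Prop :=
  ∃ n : ℕ, 1 ≤ n ∧ Z ∈ ⋂ i : Fin k, (shiftK i)^[n] ⁻¹' P

/-- `Z ∈ X_k` is weakly (Kurtz) random w.r.t. `μ`: it belongs to no Π⁰₁ class of
measure `0`. -/
def KurtzRandomK {k : ℕ} (μ : MeasureTheory.Measure ((Fin k → ℕ) → Bool))
    (Z : (Fin k → ℕ) → Bool) : Prop :=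
  ∀ P : Set ((Fin k → ℕ) → Bool), Pi01ClassK P → μ P = 0 → Z ∉ P

open scoped ENNReal

/-- The fair-coin measure on `Bool`. -/
noncomputable def fairCoin : Measure Bool := (PMF.uniformOfFintype Bool).toMeasure

instance : IsProbabilityMeasure fairCoin := by
  unfold fairCoin; infer_instance

lemma fairCoin_singleton (b : Bool) : fairCoin {b} = 2⁻¹ := by
  simp [fairCoin]

/-- The fair-coin product measure on `ι → Bool`. -/
noncomputable def coinMeasure (ι : Type*) : Measure (ι → Bool) :=
  Measure.infinitePi fun _ => fairCoin

instance (ι : Type*) : IsProbabilityMeasure (coinMeasure ι) := by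
  unfold coinMeasure; infer_instance

lemma coinMeasure_cylinder {ι : Type*} (s : Finset ι) (w : ι → Bool) :
    coinMeasure ι {Z | ∀ i ∈ s, Z i = w i} = 2⁻¹ ^ s.card := by
  have h : {Z : ι → Bool | ∀ i ∈ s, Z i = w i} = Set.pi s fun i => {w i} := by
    ext Z; simp [Set.mem_pi]
  rw [h, coinMeasure, Measure.infinitePi_pi _ fun _ _ => measurableSet_singleton _]
  simp [fairCoin_singleton]

/-- A measure giving the cylinders over an exhausting sequence of finite sets the right measure
is the fair-coin measure. -/
lemma eq_coinMeasure {ι : Type*} (B : ℕ → Finset ι) (hmono : Monotone B) (h0 : B 0 = ∅)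
    (hB : ∀ i, ∃ n, i ∈ B n) (μ : Measure (ι → Bool))
    (hμ : ∀ n (w : ι → Bool), μ {Z | ∀ i ∈ B n, Z i = w i} = 2⁻¹ ^ (B n).card) :
    μ = coinMeasure ι := by
  classical
  let C : Set (Set (ι → Bool)) := {A | ∃ (n : ℕ) (w : ι → Bool), A = {Z | ∀ i ∈ B n, Z i = w i}}
  have huniv : μ Set.univ = 1 := by simpa [h0] using hμ 0 fun _ => false
  have : IsProbabilityMeasure μ := ⟨huniv⟩
  refine ext_of_generate_finite C ?_ ?_ ?_ (by simp)
  · refine le_antisymm ?_ (MeasurableSpace.generateFrom_le ?_)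
    · refine iSup_le fun i => ?_
      obtain ⟨n, hn⟩ := hB i
      rw [MeasurableSpace.comap_le_iff_le_map]
      intro A _
      change MeasurableSet[MeasurableSpace.generateFrom C] ((fun Z : ι → Bool => Z i) ⁻¹' A)
      let ext (v : B n → Bool) : ι → Bool := fun j => if h : j ∈ B n then v ⟨j, h⟩ else false
      have h : (fun Z : ι → Bool => Z i) ⁻¹' A =
          ⋃ v ∈ {v : B n → Bool | v ⟨i, hn⟩ ∈ A}, {Z | ∀ j ∈ B n, Z j = ext v j} := by
        ext Z
        simp only [Set.mem_preimage, Set.mem_ofPred_eq, Set.mem_iUnion, exists_prop]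
        constructor
        · exact fun hZ => ⟨fun j => Z j, hZ, fun j hj => by simp [ext, hj]⟩
        · rintro ⟨v, hv, hZ⟩
          rw [hZ i hn]
          simpa [ext, hn] using hv
      rw [h]
      exact MeasurableSet.biUnion (Set.to_countable _) fun v _ =>
        MeasurableSpace.measurableSet_generateFrom ⟨n, ext v, rfl⟩
    · rintro A ⟨n, w, rfl⟩
      have h : {Z : ι → Bool | ∀ i ∈ B n, Z i = w i} = Set.pi (B n) fun i => {w i} := by
        ext Z; simp [Set.mem_pi]
      rw [h]
      exact MeasurableSet.pi (B n).countable_toSet fun _ _ => measurableSet_singleton _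
  · rintro _ ⟨n, w, rfl⟩ _ ⟨n', w', rfl⟩ ⟨Z, hZ, hZ'⟩
    refine ⟨max n n', Z, ?_⟩
    ext Y
    simp only [Set.mem_inter_iff, Set.mem_ofPred_eq] at hZ hZ' ⊢
    have h1 := hmono (le_max_left n n')
    have h2 := hmono (le_max_right n n')
    constructor
    · rintro ⟨h, h'⟩ i hi
      rcases le_total n n' with hn | hn
      · rw [max_eq_right hn] at hi
        rw [h' i hi, hZ' i hi]
      · rw [max_eq_left hn] at hi
        rw [h i hi, hZ i hi]
    · exact fun h => ⟨fun i hi => (h i (h1 hi)).trans (hZ i hi),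
        fun i hi => (h i (h2 hi)).trans (hZ' i hi)⟩
  · rintro _ ⟨n, w, rfl⟩
    rw [hμ, coinMeasure_cylinder]

/-- Reindexing along an injection preserves the fair-coin measure. -/
lemma map_coinMeasure_of_injective {ι κ : Type*} {f : κ → ι} (hf : Function.Injective f) :
    (coinMeasure ι).map (fun W j => W (f j)) = coinMeasure κ :=
  Measure.map_infinitePi_infinitePi_of_inj (P := fun _ => fairCoin) hf

lemma coinMeasure_preimage_of_injective {ι κ : Type*} {f : κ → ι} (hf : Function.Injective f)
    {A : Set (κ → Bool)} (hA : MeasurableSet A) :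
    coinMeasure ι ((fun W j => W (f j)) ⁻¹' A) = coinMeasure κ A := by
  rw [← map_coinMeasure_of_injective hf, Measure.map_apply (by fun_prop) hA]

/-- The σ-algebra generated by the coordinates in `T`. -/
@[reducible] def coordAlg {ι : Type*} (T : Set ι) : MeasurableSpace (ι → Bool) :=
  ⨆ i ∈ T, MeasurableSpace.comap (fun W : ι → Bool => W i) inferInstance

lemma coordAlg_mono {ι : Type*} {S T : Set ι} (h : S ⊆ T) : coordAlg S ≤ coordAlg T :=
  biSup_mono h

lemma coordAlg_le {ι : Type*} (T : Set ι) : coordAlg T ≤ MeasurableSpace.pi :=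
  iSup₂_le fun i _ => (measurable_pi_apply i).comap_le

/-- Reading coordinates in `T` only is measurable for `coordAlg T`. -/
lemma measurableSet_coordAlg_preimage {ι κ : Type*} {T : Set ι} {f : κ → ι}
    (hf : ∀ j, f j ∈ T) {A : Set (κ → Bool)} (hA : MeasurableSet A) :
    MeasurableSet[coordAlg T] ((fun (W : ι → Bool) j => W (f j)) ⁻¹' A) := by
  have h : Measurable[coordAlg T] fun (W : ι → Bool) j => W (f j) :=
    @measurable_pi_lambda _ _ _ (coordAlg T) _ _ fun j =>
      measurable_iff_comap_le.2 (le_iSup₂_of_le (f j) (hf j) le_rfl)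
  exact h hA

/-- A set depending on finitely many coordinates in `T` is measurable for `coordAlg T`. -/
lemma measurableSet_coordAlg_of_finite {ι : Type*} {T : Set ι} (hT : T.Finite)
    {A : Set (ι → Bool)} (hA : ∀ W W', (∀ i ∈ T, W i = W' i) → W ∈ A → W' ∈ A) :
    MeasurableSet[coordAlg T] A := by
  have : Finite T := hT
  have h : A = (fun (W : ι → Bool) (j : T) => W j) ⁻¹'
      ((fun (W : ι → Bool) (j : T) => W j) '' A) := by
    refine Set.Subset.antisymm (Set.subset_preimage_image _ _) ?_
    rintro W ⟨W', hW', hWW⟩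
    exact hA W' W (fun i hi => congrFun hWW ⟨i, hi⟩) hW'
  rw [h]
  exact measurableSet_coordAlg_preimage (fun j => j.2) (Set.toFinite _).measurableSet

lemma coinMeasure_inter {ι : Type*} {S T : Set ι} (hST : Disjoint S T) {A B : Set (ι → Bool)}
    (hA : MeasurableSet[coordAlg S] A) (hB : MeasurableSet[coordAlg T] B) :
    coinMeasure ι (A ∩ B) = coinMeasure ι A * coinMeasure ι B := by
  have h : ProbabilityTheory.iIndep
      (fun i : ι => MeasurableSpace.comap (fun W : ι → Bool => W i) inferInstance)
      (coinMeasure ι) :=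
    (ProbabilityTheory.iIndepFun_infinitePi (P := fun _ : ι => fairCoin)
      (X := fun _ b => b) fun _ => measurable_id).iIndep
  have hi := ProbabilityTheory.indep_iSup_of_disjoint
    (fun i => (measurable_pi_apply i).comap_le) h hST
  exact (ProbabilityTheory.Indep_iff _ _ _).1 hi A B hA hB

lemma coinMeasure_biInter {ι κ : Type*} (s : Finset κ) {T : κ → Set ι}
    (hT : Pairwise fun i j => Disjoint (T i) (T j)) {A : κ → Set (ι → Bool)}
    (hA : ∀ i, MeasurableSet[coordAlg (T i)] (A i)) :
    coinMeasure ι (⋂ i ∈ s, A i) = ∏ i ∈ s, coinMeasure ι (A i) := by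
  classical
  induction s using Finset.induction_on with
  | empty => simp
  | insert a s ha ih =>
    rw [Finset.prod_insert ha, ← ih, Finset.set_biInter_insert]
    refine coinMeasure_inter (S := T a) (T := ⋃ i ∈ s, T i) ?_ (hA a) ?_
    · simp only [Set.disjoint_iUnion_right]
      exact fun i hi => hT fun h => ha (h ▸ hi)
    · exact @MeasurableSet.biInter _ _ (coordAlg _) _ _ s.countable_toSet fun i hi =>
        coordAlg_mono (Set.subset_biUnion_of_mem hi) _ (hA i)

/-- Asymptotic independence: if the decreasing sequence `C` decreases to a set of positive
measure, and suitable re-indexings eventually map finite blocks of coordinates to pairwise disjoint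
sets, then the simultaneous preimages have measure bounded away from `0`. -/
lemma exists_pos_le_coinMeasure_iInter {ι κ σ : Type*} [Fintype σ] {C : ℕ → Set (κ → Bool)}
    (hanti : Antitone C) (D : ℕ → Set κ) (hD : ∀ s, (D s).Finite)
    (hC : ∀ s W W', (∀ i ∈ D s, W i = W' i) → W ∈ C s → W' ∈ C s)
    (hpos : coinMeasure κ (⋂ s, C s) ≠ 0) (g : σ → ℕ → κ → ι)
    (hg : ∀ i N, Function.Injective (g i N))
    (hdisj : ∀ s, ∃ N₀, ∀ N ≥ N₀, Pairwise fun i j => Disjoint (g i N '' D s) (g j N '' D s)) :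
    ∃ c : ℝ≥0∞, c ≠ 0 ∧ ∃ N₀, ∀ N ≥ N₀,
      c ≤ coinMeasure ι (⋂ i, (fun W j => W (g i N j)) ⁻¹' ⋂ s, C s) := by
  set P := ⋂ s, C s with hPdef
  have hCm : ∀ s, MeasurableSet (C s) := fun s =>
    coordAlg_le _ _ (measurableSet_coordAlg_of_finite (hD s) (hC s))
  have hPm : MeasurableSet P := .iInter hCm
  set p := coinMeasure κ P with hp
  have hp1 : p ≤ 1 := prob_le_one
  have hptop : p ≠ ∞ := (hp1.trans_lt ENNReal.one_lt_top).ne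
  set K := Fintype.card σ with hK
  set ε : ℝ≥0∞ := p ^ K / 2 / (K + 1) with hε
  have hpK : p ^ K ≠ 0 := pow_ne_zero _ hpos
  have hpKtop : p ^ K ≠ ∞ := ENNReal.pow_ne_top hptop
  have hε0 : ε ≠ 0 := by
    rw [hε]; exact (ENNReal.div_pos (ENNReal.half_pos hpK).ne' (by finiteness)).ne'
  have htend := tendsto_measure_iInter_atTop (μ := coinMeasure κ)
    (fun s => (hCm s).nullMeasurableSet) hanti ⟨0, measure_ne_top _ _⟩
  obtain ⟨s, hs⟩ := (htend.eventually_lt_const (ENNReal.lt_add_right hptop hε0)).exists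
  obtain ⟨N₀, hN₀⟩ := hdisj s
  refine ⟨p ^ K / 2, (ENNReal.half_pos hpK).ne', N₀, fun N hN => ?_⟩
  have hdiff : coinMeasure κ (C s \ P) ≤ ε := by
    rw [measure_sdiff (Set.iInter_subset _ s) hPm.nullMeasurableSet hptop]
    exact tsub_le_iff_left.2 hs.le
  have hprod : p ^ K ≤ coinMeasure ι (⋂ i, (fun W j => W (g i N j)) ⁻¹' C s) := by
    have h := coinMeasure_biInter (ι := ι) Finset.univ (hN₀ N hN)
      (A := fun i => (fun W j => W (g i N j)) ⁻¹' C s) fun i =>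
        measurableSet_coordAlg_of_finite ((hD s).image _) fun W W' hW =>
          hC s _ _ fun j hj => hW _ (Set.mem_image_of_mem _ hj)
    simp only [Finset.mem_univ, Set.iInter_true] at h
    rw [h, hK, ← Finset.card_univ, ← Finset.prod_const]
    refine Finset.prod_le_prod' fun i _ => ?_
    rw [coinMeasure_preimage_of_injective (hg i N) (hCm s)]
    exact measure_mono (Set.iInter_subset _ s)
  have hsub : (⋂ i, (fun (W : ι → Bool) j => W (g i N j)) ⁻¹' C s) ⊆
      (⋂ i, (fun (W : ι → Bool) j => W (g i N j)) ⁻¹' P) ∪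
        ⋃ i, (fun (W : ι → Bool) j => W (g i N j)) ⁻¹' (C s \ P) := by
    intro W hW
    by_cases h : W ∈ ⋂ i, (fun (W : ι → Bool) j => W (g i N j)) ⁻¹' P
    · exact .inl h
    · simp only [Set.mem_iInter, not_forall] at h
      obtain ⟨i, hi⟩ := h
      exact .inr (Set.mem_iUnion.2 ⟨i, Set.mem_iInter.1 hW i, hi⟩)
  have herr : coinMeasure ι (⋃ i, (fun W j => W (g i N j)) ⁻¹' (C s \ P)) ≤ p ^ K / 2 := by
    refine (measure_iUnion_fintype_le _ _).trans ?_
    calc ∑ i, coinMeasure ι ((fun W j => W (g i N j)) ⁻¹' (C s \ P))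
        ≤ ∑ _i : σ, ε := Finset.sum_le_sum fun i _ => by
          rw [coinMeasure_preimage_of_injective (hg i N) ((hCm s).diff hPm)]
          exact hdiff
      _ = K * ε := by simp [hK]
      _ ≤ (K + 1) * ε := by gcongr; exact le_self_add
      _ = p ^ K / 2 := ENNReal.mul_div_cancel (by simp) (by finiteness)
  have htot := hprod.trans ((measure_mono hsub).trans (measure_union_le _ _))
  rw [← ENNReal.add_halves (p ^ K)] at htot
  exact (ENNReal.add_le_add_iff_right (ENNReal.div_ne_top hpKtop two_ne_zero)).1
    (htot.trans (by gcongr))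

/-- The state, after `t` steps, of a process counting hits: it records the time of the last hit
and the number of hits so far. After a hit at time `s` it waits for `hit W (nf s) t` to hold. -/
def hitState (hit : (ℕ → Bool) → ℕ → ℕ → Bool) (nf : ℕ → ℕ) (W : ℕ → Bool) (t : ℕ) : ℕ × ℕ :=
  Nat.rec (0, 0) (fun t s => bif hit W (nf s.1) (t + 1) then (t + 1, s.2 + 1) else s) t

section HitState

variable {hit : (ℕ → Bool) → ℕ → ℕ → Bool} {nf : ℕ → ℕ}

lemma hitState_succ (W : ℕ → Bool) (t : ℕ) : hitState hit nf W (t + 1) =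
    bif hit W (nf (hitState hit nf W t).1) (t + 1) then (t + 1, (hitState hit nf W t).2 + 1)
    else hitState hit nf W t := rfl

lemma hitState_congr (hloc : ∀ W W' N t, (∀ i < t, W i = W' i) → hit W N t = hit W' N t)
    {W W' : ℕ → Bool} {t : ℕ} (h : ∀ i < t, W i = W' i) :
    hitState hit nf W t = hitState hit nf W' t := by
  induction t with
  | zero => rfl
  | succ t ih =>
    rw [hitState_succ, hitState_succ, ih fun i hi => h i (hi.trans t.lt_succ_self),
      hloc W W' _ _ h]

lemma hitState_fst_le (W : ℕ → Bool) (t : ℕ) : (hitState hit nf W t).1 ≤ t := by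
  induction t with
  | zero => exact le_rfl
  | succ t ih =>
    rw [hitState_succ]
    cases hit W (nf (hitState hit nf W t).1) (t + 1)
    · simp; omega
    · simp

lemma hitState_count_mono (W : ℕ → Bool) : Monotone fun t => (hitState hit nf W t).2 := by
  refine monotone_nat_of_le_succ fun t => ?_
  rw [hitState_succ]
  cases hit W (nf (hitState hit nf W t).1) (t + 1) <;> simp

/-- The state does not change after the last hit. -/
lemma hitState_fst_self (W : ℕ → Bool) (t : ℕ) :
    hitState hit nf W (hitState hit nf W t).1 = hitState hit nf W t := by
  induction t with
  | zero => rfl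
  | succ t ih =>
    cases h : hit W (nf (hitState hit nf W t).1) (t + 1)
    · have hs : hitState hit nf W (t + 1) = hitState hit nf W t := by rw [hitState_succ, h]; rfl
      rw [hs, ih]
    · have hs : (hitState hit nf W (t + 1)).1 = t + 1 := by rw [hitState_succ, h]; rfl
      rw [hs]

lemma hitState_count_lt (W : ℕ → Bool) {t l : ℕ} (ht : t < l)
    (hl : (hitState hit nf W l).1 = l) : (hitState hit nf W t).2 < (hitState hit nf W l).2 := by
  obtain ⟨l, rfl⟩ := Nat.exists_eq_succ_of_ne_zero (Nat.ne_of_gt (Nat.zero_lt_of_lt ht))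
  have hmono := hitState_count_mono (hit := hit) (nf := nf) W (Nat.le_of_lt_succ ht)
  cases h : hit W (nf (hitState hit nf W l).1) (l + 1)
  · have hs : hitState hit nf W (l + 1) = hitState hit nf W l := by rw [hitState_succ, h]; rfl
    rw [Nat.succ_eq_add_one, hs] at hl
    have := hitState_fst_le (hit := hit) (nf := nf) W l
    omega
  · have hs : (hitState hit nf W (l + 1)).2 = (hitState hit nf W l).2 + 1 := by
      rw [hitState_succ, h]; rfl
    rw [Nat.succ_eq_add_one, hs]
    exact Nat.lt_succ_of_le hmono

lemma exists_hitState_eq_of_lt_count {E : ℕ → Set (ℕ → Bool)}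
    (hsound : ∀ W N t, hit W N t = true → W ∈ E N) {W : ℕ → Bool} {m t : ℕ}
    (h : m < (hitState hit nf W t).2) :
    ∃ l, hitState hit nf W l = (l, m) ∧ W ∈ E (nf l) := by
  induction t with
  | zero => exact absurd h (Nat.not_lt_zero m)
  | succ t ih =>
    by_cases h' : m < (hitState hit nf W t).2
    · exact ih h'
    cases hh : hit W (nf (hitState hit nf W t).1) (t + 1)
    · rw [hitState_succ, hh] at h
      exact absurd h h'
    · rw [hitState_succ, hh, cond_true] at h
      have hm : (hitState hit nf W t).2 = m := by dsimp only at h; omega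
      refine ⟨(hitState hit nf W t).1, ?_, hsound _ _ _ hh⟩
      rw [hitState_fst_self, ← hm]

/-- If every set `E (nf l)` multiplies by at most `q` the measure of the sets depending on the
first `l` coordinates, then `m` hits occur with probability at most `q ^ m`. -/
lemma coinMeasure_count_le
    (hloc : ∀ W W' N t, (∀ i < t, W i = W' i) → hit W N t = hit W' N t)
    {E : ℕ → Set (ℕ → Bool)} (hsound : ∀ W N t, hit W N t = true → W ∈ E N) {q : ℝ≥0∞}
    (hq : ∀ l A, MeasurableSet[coordAlg (Set.Iio l)] A →
      coinMeasure ℕ (A ∩ E (nf l)) ≤ q * coinMeasure ℕ A) (m : ℕ) :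
    coinMeasure ℕ {W | ∃ t, m ≤ (hitState hit nf W t).2} ≤ q ^ m := by
  induction m with
  | zero => simp
  | succ m ih =>
    let A (l : ℕ) : Set (ℕ → Bool) := {W | hitState hit nf W l = (l, m)}
    have hA (l : ℕ) : MeasurableSet[coordAlg (Set.Iio l)] (A l) :=
      measurableSet_coordAlg_of_finite (Set.finite_Iio l) fun W W' hW (h : _ = _) =>
        (hitState_congr hloc fun i hi => (hW i hi).symm).trans h
    have hdisj : Pairwise (Function.onFun Disjoint A) := by
      have key : ∀ l l', l < l' → Disjoint (A l) (A l') := fun l l' hl =>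
        Set.disjoint_left.2 fun W (h : _ = _) (h' : _ = _) => by
          have := hitState_count_lt (hit := hit) (nf := nf) W hl (by rw [h'])
          rw [h, h'] at this
          exact lt_irrefl _ this
      intro l l' hne
      rcases hne.lt_or_gt with h | h
      · exact key l l' h
      · exact (key l' l h).symm
    calc coinMeasure ℕ {W | ∃ t, m + 1 ≤ (hitState hit nf W t).2}
        ≤ coinMeasure ℕ (⋃ l, A l ∩ E (nf l)) := by
          refine measure_mono fun W ⟨t, ht⟩ => ?_
          exact Set.mem_iUnion.2 (exists_hitState_eq_of_lt_count hsound ht)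
      _ ≤ ∑' l, coinMeasure ℕ (A l ∩ E (nf l)) := measure_iUnion_le _
      _ ≤ ∑' l, q * coinMeasure ℕ (A l) := ENNReal.tsum_le_tsum fun l => hq l _ (hA l)
      _ = q * coinMeasure ℕ (⋃ l, A l) := by
          rw [ENNReal.tsum_mul_left, measure_iUnion hdisj fun l => coordAlg_le _ _ (hA l)]
      _ ≤ q * q ^ m := by
          gcongr
          refine le_trans (measure_mono ?_) ih
          exact Set.iUnion_subset fun l W (h : _ = _) => ⟨l, by rw [h]⟩
      _ = q ^ (m + 1) := (pow_succ' q m).symm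

/-- A point all of whose waits are eventually successful has unboundedly many hits. -/
lemma exists_le_count {W : ℕ → Bool}
    (hW : ∀ l, ∃ t₀, ∀ t ≥ t₀, hit W (nf l) t = true) (m : ℕ) :
    ∃ t, m ≤ (hitState hit nf W t).2 := by
  induction m with
  | zero => exact ⟨0, Nat.zero_le _⟩
  | succ m ih =>
    obtain ⟨t, ht⟩ := ih
    by_contra! hcon
    have hconst : ∀ d, hitState hit nf W (t + d) = hitState hit nf W t := by
      intro d
      induction d with
      | zero => rfl
      | succ d ihd =>
        have hc := hcon (t + d + 1)
        rw [hitState_succ, ihd] at hc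
        rw [← add_assoc, hitState_succ, ihd]
        cases hh : hit W (nf (hitState hit nf W t).1) (t + d + 1)
        · rfl
        · rw [hh, cond_true] at hc
          dsimp only at hc
          omega
    obtain ⟨t₀, ht₀⟩ := hW (hitState hit nf W t).1
    have hc := hcon (t + t₀ + 1)
    rw [hitState_succ, hconst, ht₀ _ (by omega), cond_true] at hc
    dsimp only at hc
    omega

end HitState

/-- Bounded existential quantification over `{0, …, t - 1}`. -/
def boundedAny (p : ℕ → Bool) (t : ℕ) : Bool :=
  Nat.rec false (fun j b => b || p j) t

/-- Bounded universal quantification over `{0, …, t - 1}`. -/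
def boundedAll (p : ℕ → Bool) (t : ℕ) : Bool :=
  Nat.rec true (fun j b => b && p j) t

lemma boundedAny_eq_true {p : ℕ → Bool} {t : ℕ} :
    boundedAny p t = true ↔ ∃ j < t, p j = true := by
  induction t with
  | zero => simp [boundedAny]
  | succ t ih =>
    change (boundedAny p t || p t) = true ↔ _
    rw [Bool.or_eq_true, ih, Nat.exists_lt_succ_right]

lemma boundedAll_eq_true {p : ℕ → Bool} {t : ℕ} :
    boundedAll p t = true ↔ ∀ j < t, p j = true := by
  induction t with
  | zero => simp [boundedAll]
  | succ t ih =>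
    change (boundedAll p t && p t) = true ↔ _
    rw [Bool.and_eq_true, ih, Nat.forall_lt_succ_right]

section Computability

variable {α : Type*} [Primcodable α]

lemma Computable.boundedAny {p : α → ℕ → Bool} {t : α → ℕ} (hp : Computable₂ p)
    (ht : Computable t) : Computable fun x => boundedAny (p x) (t x) :=
  Computable.nat_rec ht (Computable.const false)
    (Primrec.or.to_comp.comp (Computable.snd.comp Computable.snd)
      (hp.comp Computable.fst (Computable.fst.comp Computable.snd))).to₂

lemma Computable.boundedAll {p : α → ℕ → Bool} {t : α → ℕ} (hp : Computable₂ p)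
    (ht : Computable t) : Computable fun x => boundedAll (p x) (t x) :=
  Computable.nat_rec ht (Computable.const true)
    (Primrec.and.to_comp.comp (Computable.snd.comp Computable.snd)
      (hp.comp Computable.fst (Computable.fst.comp Computable.snd))).to₂

lemma Computable.list_any {ι : Type*} (l : List ι) {p : ι → α → Bool}
    (hp : ∀ i, Computable (p i)) : Computable fun x => l.any fun i => p i x := by
  induction l with
  | nil => exact Computable.const false
  | cons i l ih => exact Primrec.or.to_comp.comp (hp i) ih

lemma Computable.finset_sum {ι : Type*} (s : Finset ι) {p : ι → α → ℕ}
    (hp : ∀ i, Computable (p i)) : Computable fun x => ∑ i ∈ s, p i x := by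
  classical
  induction s using Finset.induction_on with
  | empty => exact Computable.const 0
  | insert i s hi ih =>
    simp only [Finset.sum_insert hi]
    exact Primrec.nat_add.to_comp.comp (hp i) ih

lemma Computable.fin_lam {σ : Type*} [Primcodable σ] {n : ℕ} {p : Fin n → α → σ}
    (hp : ∀ i, Computable (p i)) : Computable fun x i => p i x := by
  have h : Computable fun v : List.Vector σ n => v.get :=
    (Primrec.fin_curry.2 Primrec.vector_get).to_comp
  refine (h.comp (Computable.vector_ofFn hp)).of_eq fun x => ?_
  funext i
  simp

lemma Primrec.natPow : Primrec₂ ((· ^ ·) : ℕ → ℕ → ℕ) :=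
  Primrec₂.unpaired'.1 Nat.Primrec.pow

lemma computable_hitState {hit : (ℕ → Bool) → ℕ → ℕ → Bool} {nf : ℕ → ℕ}
    (hhit : Computable fun x : List Bool × ℕ × ℕ => hit (fun i => x.1.getD i false) x.2.1 x.2.2)
    (hnf : Computable nf) :
    Computable fun σ : List Bool => hitState hit nf (fun i => σ.getD i false) σ.length := by
  have hs : Computable fun x : List Bool × ℕ × ℕ × ℕ => x.2.2 :=
    Computable.snd.comp Computable.snd
  have ht : Computable fun x : List Bool × ℕ × ℕ × ℕ => x.2.1 + 1 :=
    Computable.succ.comp (Computable.fst.comp Computable.snd)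
  exact Computable.nat_rec Computable.list_length (Computable.const (0, 0))
    (Computable.cond
      (hhit.comp (Computable.fst.pair ((hnf.comp (Computable.fst.comp hs)).pair ht)))
      (ht.pair (Computable.succ.comp (Computable.snd.comp hs))) hs).to₂

end Computability

/-- A Martin-Löf random sequence passes the test asking for unboundedly many hits. -/
lemma MLRandom.exists_count_lt {hit : (ℕ → Bool) → ℕ → ℕ → Bool} {nf : ℕ → ℕ} {W : ℕ → Bool}
    (hW : MLRandom (coinMeasure ℕ) W)
    (hhit : Computable fun x : List Bool × ℕ × ℕ => hit (fun i => x.1.getD i false) x.2.1 x.2.2)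
    (hnf : Computable nf)
    (hloc : ∀ W W' N t, (∀ i < t, W i = W' i) → hit W N t = hit W' N t)
    {E : ℕ → Set (ℕ → Bool)} (hsound : ∀ W N t, hit W N t = true → W ∈ E N) {q : ℝ≥0∞}
    (hq1 : q < 1) (hq : ∀ l A, MeasurableSet[coordAlg (Set.Iio l)] A →
      coinMeasure ℕ (A ∩ E (nf l)) ≤ q * coinMeasure ℕ A) :
    ∃ m, ∀ t, (hitState hit nf W t).2 < m := by
  obtain ⟨c, hc⟩ : ∃ c : ℕ, q ^ c ≤ 2⁻¹ :=
    ((ENNReal.tendsto_pow_atTop_nhds_zero_of_lt_one hq1).eventually_le_const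
      (by simp)).exists
  let cnt (σ : List Bool) : ℕ := (hitState hit nf (fun i => σ.getD i false) σ.length).2
  have hcnt : Computable cnt := Computable.snd.comp (computable_hitState hhit hnf)
  let S (m : ℕ) : Set (List Bool) := {σ | c * m ≤ cnt σ}
  have hstate {σ : List Bool} {V : ℕ → Bool} (hσ : IsPrefixOf σ V) :
      cnt σ = (hitState hit nf V σ.length).2 := by
    dsimp only [cnt]
    rw [hitState_congr hloc hσ]
  have hS : MLTest (coinMeasure ℕ) S := by
    refine ⟨⟨fun m n => (Encodable.decode (α := List Bool) n).bind fun σ =>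
      bif decide (c * m ≤ cnt σ) then some σ else none, ?_, fun m => ?_⟩, fun m => ?_⟩
    · refine Computable.option_bind (Computable.decode.comp Computable.snd) ?_
      refine Computable.cond ?_ (Computable.option_some.comp Computable.snd)
        (Computable.const none)
      exact Primrec.nat_le.decide.to_comp.comp
        (Primrec.nat_mul.to_comp.comp (Computable.const c)
          (Computable.fst.comp Computable.fst))
        (hcnt.comp Computable.snd)
    · ext σ
      simp only [S, Set.mem_ofPred_eq]
      constructor
      · exact fun h => ⟨Encodable.encode σ, by simp [h]⟩
      · rintro ⟨n, hn⟩
        obtain ⟨τ, -, hτ⟩ := Option.bind_eq_some_iff.1 hn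
        by_cases h : c * m ≤ cnt τ
        · simp only [h, decide_true, cond_true, Option.some.injEq] at hτ
          exact hτ ▸ h
        · simp [h] at hτ
    · calc coinMeasure ℕ (openCl (S m))
          ≤ coinMeasure ℕ {W | ∃ t, c * m ≤ (hitState hit nf W t).2} := by
            refine measure_mono ?_
            rintro V ⟨σ, hσ, hσV⟩
            exact ⟨σ.length, hstate hσV ▸ hσ⟩
        _ ≤ q ^ (c * m) := coinMeasure_count_le hloc hsound hq _
        _ ≤ 2⁻¹ ^ m := by rw [pow_mul]; gcongr
  obtain ⟨m, hm⟩ := hW S hS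
  refine ⟨c * m, fun t => ?_⟩
  by_contra! h
  have hpre : IsPrefixOf (List.ofFn fun i : Fin t => W i) W := by
    intro i hi
    rw [List.length_ofFn] at hi
    simp [List.getD, hi]
  refine hm ⟨_, ?_, hpre⟩
  change c * m ≤ cnt _
  rwa [hstate hpre, List.length_ofFn]

section Arrays

variable {k : ℕ}

/-- The index `u` moved by `N` in direction `i`. -/
def shiftIndex (i : Fin k) (N : ℕ) (u : Fin k → ℕ) : Fin k → ℕ :=
  fun j => if j = i then u j + N else u j

/-- The index with entries the last `k` digits of `a` in base `n`. -/
def digitIndex (k n a : ℕ) : Fin k → ℕ := fun j => a / n ^ (j : ℕ) % n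

lemma shiftIndex_injective (i : Fin k) (N : ℕ) : Function.Injective (shiftIndex i N) := by
  intro u v h
  funext j
  have := congrFun h j
  simp only [shiftIndex] at this
  split_ifs at this <;> omega

lemma shiftK_iterate (i : Fin k) (N : ℕ) (Z : (Fin k → ℕ) → Bool) :
    (shiftK i)^[N] Z = fun u => Z (shiftIndex i N u) := by
  induction N generalizing Z with
  | zero =>
    funext u
    exact congrArg Z (funext fun j => by simp [shiftIndex])
  | succ N ih =>
    rw [Function.iterate_succ_apply, ih]
    funext u
    refine congrArg Z (funext fun j => ?_)
    simp only [shiftIndex]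
    split_ifs <;> omega

lemma arrayAgrees_iff {n : ℕ} {l : List Bool} {Z : (Fin k → ℕ) → Bool} :
    ArrayAgrees n l Z ↔
      l.length = n ^ k ∧ ∀ a < l.length, l.getD a false = Z (digitIndex k n a) := by
  refine and_congr_right fun hl => ?_
  rw [hl]
  have key (u : Fin k → Fin n) :
      digitIndex k n (finFunctionFinEquiv u : ℕ) = fun j => (u j : ℕ) := by
    funext j
    exact congrArg Fin.val (congrFun (finFunctionFinEquiv.symm_apply_apply u) j)
  constructor
  · intro h a ha
    obtain ⟨u, hu⟩ := finFunctionFinEquiv.surjective (⟨a, ha⟩ : Fin (n ^ k))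
    have := h u
    rwa [← key, hu] at this
  · intro h u
    rw [← key]
    exact h _ (finFunctionFinEquiv u).isLt

/-- The index box of the arrays of size `n`. -/
def indexBox (k n : ℕ) : Finset (Fin k → ℕ) := Fintype.piFinset fun _ => Finset.range n

lemma mem_indexBox {n : ℕ} {u : Fin k → ℕ} : u ∈ indexBox k n ↔ ∀ j, u j < n := by
  simp [indexBox]

lemma ArrayAgrees.congr {n : ℕ} {l : List Bool} {Z Z' : (Fin k → ℕ) → Bool}
    (h : ∀ u ∈ indexBox k n, Z u = Z' u) (hZ : ArrayAgrees n l Z) : ArrayAgrees n l Z' :=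
  ⟨hZ.1, fun u => (hZ.2 u).trans (h _ (mem_indexBox.2 fun j => (u j).isLt))⟩

lemma IsUniformMeasureK.eq_coinMeasure (hk : 1 ≤ k) {μ : Measure ((Fin k → ℕ) → Bool)}
    (hμ : IsUniformMeasureK μ) : μ = coinMeasure (Fin k → ℕ) := by
  refine _root_.eq_coinMeasure (indexBox k) ?_ ?_ ?_ μ fun n w => ?_
  · intro m n hmn u hu
    exact mem_indexBox.2 fun j => (mem_indexBox.1 hu j).trans_le hmn
  · ext u
    simpa [mem_indexBox] using ⟨(⟨0, hk⟩ : Fin k)⟩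
  · intro u
    exact ⟨∑ j, u j + 1, mem_indexBox.2 fun j =>
      Nat.lt_succ_of_le (Finset.single_le_sum (fun _ _ => Nat.zero_le _) (Finset.mem_univ j))⟩
  · let l : List Bool := List.ofFn fun a : Fin (n ^ k) => w (digitIndex k n a)
    have hl : l.length = n ^ k := List.length_ofFn
    have hw : ArrayAgrees n l w := arrayAgrees_iff.2 ⟨hl, fun a ha => by
      rw [hl] at ha
      simp [l, List.getD, ha]⟩
    have h : {Z : (Fin k → ℕ) → Bool | ∀ u ∈ indexBox k n, Z u = w u} =
        {Z | ArrayAgrees n l Z} := by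
      ext Z
      refine ⟨fun h => hw.congr fun u hu => (h u hu).symm, fun h u hu => ?_⟩
      have hu' := mem_indexBox.1 hu
      exact (h.2 fun j => ⟨u j, hu' j⟩).symm.trans (hw.2 fun j => ⟨u j, hu' j⟩)
    rw [h, hμ n l hl]
    simp [indexBox]

lemma IsUniformMeasure.eq_coinMeasure {ν : Measure (ℕ → Bool)} (hν : IsUniformMeasure ν) :
    ν = coinMeasure ℕ := by
  refine _root_.eq_coinMeasure Finset.range Finset.range_mono rfl
    (fun i => ⟨i + 1, Finset.self_mem_range_succ i⟩) ν fun n w => ?_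
  have h : {Z : ℕ → Bool | ∀ i ∈ Finset.range n, Z i = w i} =
      {Z | IsPrefixOf (List.ofFn fun i : Fin n => w i) Z} := by
    ext Z
    simp only [IsPrefixOf, List.length_ofFn, Finset.mem_range, Set.mem_ofPred_eq]
    refine forall₂_congr fun i hi => ?_
    simp [List.getD, hi, eq_comm]
  rw [h, hν, List.length_ofFn, Finset.card_range]

/-- Within the first `t` enumerated arrays, some array agrees with a shift of `W` by `N`, as can be
seen from the first `t` bits of `W`. -/
def arrayHit (f : ℕ → Option (ℕ × List Bool)) (e : (Fin k → ℕ) → ℕ) (W : ℕ → Bool) (N t : ℕ) :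
    Bool :=
  (List.finRange k).any fun i => boundedAny (fun j => ((f j).map fun p =>
    p.2.length == p.1 ^ k && boundedAll (fun a =>
      decide (e (shiftIndex i N (digitIndex k p.1 a)) < t) &&
        p.2.getD a false == W (e (shiftIndex i N (digitIndex k p.1 a)))) p.2.length).getD false) t

lemma arrayHit_eq_true {f : ℕ → Option (ℕ × List Bool)} {e : (Fin k → ℕ) → ℕ} {W : ℕ → Bool}
    {N t : ℕ} : arrayHit f e W N t = true ↔ ∃ i, ∃ j < t, ∃ p, f j = some p ∧
      p.2.length = p.1 ^ k ∧ ∀ a < p.2.length, e (shiftIndex i N (digitIndex k p.1 a)) < t ∧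
        p.2.getD a false = W (e (shiftIndex i N (digitIndex k p.1 a))) := by
  simp only [arrayHit, List.any_eq_true, List.mem_finRange, true_and, boundedAny_eq_true]
  refine exists_congr fun i => exists_congr fun j => and_congr_right fun _ => ?_
  cases f j with
  | none => simp
  | some p =>
    simp only [Option.map_some, Option.getD_some, Bool.and_eq_true, beq_iff_eq,
      boundedAll_eq_true, decide_eq_true_eq, Option.some.injEq, exists_eq_left']

lemma arrayHit_congr {f : ℕ → Option (ℕ × List Bool)} {e : (Fin k → ℕ) → ℕ} {W W' : ℕ → Bool}
    {N t : ℕ} (h : ∀ i < t, W i = W' i) : arrayHit f e W N t = arrayHit f e W' N t := by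
  rw [Bool.eq_iff_iff, arrayHit_eq_true, arrayHit_eq_true]
  refine exists_congr fun i => exists_congr fun j => and_congr_right fun _ =>
    exists_congr fun p => and_congr_right fun _ => and_congr_right fun _ =>
      forall₂_congr fun a _ => and_congr_right fun ha => ?_
  rw [h _ ha]

lemma arrayHit_sound {f : ℕ → Option (ℕ × List Bool)} {e : (Fin k → ℕ) → ℕ} {W : ℕ → Bool}
    {N t : ℕ} (h : arrayHit f e W N t = true) :
    ∃ i : Fin k, (fun u => W (e (shiftIndex i N u))) ∈ openClK {p | ∃ j, f j = some p} := by
  obtain ⟨i, j, -, p, hp, hl, ha⟩ := arrayHit_eq_true.1 h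
  exact ⟨i, p, ⟨j, hp⟩, arrayAgrees_iff.2 ⟨hl, fun a h => (ha a h).2⟩⟩

lemma arrayHit_complete {f : ℕ → Option (ℕ × List Bool)} {e : (Fin k → ℕ) → ℕ} {W : ℕ → Bool}
    {N : ℕ} {i : Fin k}
    (h : (fun u => W (e (shiftIndex i N u))) ∈ openClK {p | ∃ j, f j = some p}) :
    ∃ t₀, ∀ t ≥ t₀, arrayHit f e W N t = true := by
  obtain ⟨p, ⟨j, hj⟩, hp⟩ := h
  obtain ⟨hl, ha⟩ := arrayAgrees_iff.1 hp
  refine ⟨j + 1 + ∑ a ∈ Finset.range p.2.length,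
    (e (shiftIndex i N (digitIndex k p.1 a)) + 1), fun t ht => ?_⟩
  refine arrayHit_eq_true.2 ⟨i, j, by omega, p, hj, hl, fun a h => ⟨?_, ha a h⟩⟩
  have := Finset.single_le_sum
    (f := fun a => e (shiftIndex i N (digitIndex k p.1 a)) + 1) (fun _ _ => Nat.zero_le _)
    (Finset.mem_range.2 h)
  omega

lemma computable_arrayHit {f : ℕ → Option (ℕ × List Bool)} (hf : Computable f)
    {e : (Fin k → ℕ) → ℕ} (he : Computable e) :
    Computable fun x : List Bool × ℕ × ℕ =>
      arrayHit f e (fun i => x.1.getD i false) x.2.1 x.2.2 := by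
  have hgetD : Computable₂ fun (l : List Bool) n => l.getD n false :=
    (Primrec.list_getD false).to_comp
  have heqN : Computable₂ fun a b : ℕ => a == b := Primrec.beq.to_comp
  have heqB : Computable₂ fun a b : Bool => a == b := Primrec.beq.to_comp
  have hlt : Computable₂ fun a b : ℕ => decide (a < b) := Primrec.nat_lt.decide.to_comp
  have hand : Computable₂ (· && ·) := Primrec.and.to_comp
  have hpos (i : Fin k) : Computable fun y : ℕ × ℕ × ℕ =>
      e (shiftIndex i y.1 (digitIndex k y.2.1 y.2.2)) := by
    have hn : Computable fun y : ℕ × ℕ × ℕ => y.2.1 := Computable.fst.comp Computable.snd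
    have ha : Computable fun y : ℕ × ℕ × ℕ => y.2.2 := Computable.snd.comp Computable.snd
    refine he.comp (Computable.fin_lam fun j => ?_)
    have hd : Computable fun y : ℕ × ℕ × ℕ => y.2.2 / y.2.1 ^ (j : ℕ) % y.2.1 :=
      Primrec.nat_mod.to_comp.comp (Primrec.nat_div.to_comp.comp ha
        (Primrec.natPow.to_comp.comp hn (Computable.const _))) hn
    by_cases h : j = i
    · simpa only [shiftIndex, digitIndex, h, if_true] using
        Primrec.nat_add.to_comp.comp (h ▸ hd) Computable.fst
    · simpa only [shiftIndex, digitIndex, h, if_false] using hd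
  refine Computable.list_any _ fun i => Computable.boundedAny ?_
    (Computable.snd.comp Computable.snd)
  refine Computable.option_getD (Computable.option_map (hf.comp Computable.snd) ?_)
    (Computable.const false)
  have hp : Computable fun y : ((List Bool × ℕ × ℕ) × ℕ) × ℕ × List Bool => y.2 :=
    Computable.snd
  have hlen : Computable fun y : ((List Bool × ℕ × ℕ) × ℕ) × ℕ × List Bool => y.2.2.length :=
    Computable.list_length.comp (Computable.snd.comp hp)
  refine hand.comp (heqN.comp hlen (Primrec.natPow.to_comp.comp (Computable.fst.comp hp)
    (Computable.const k))) (Computable.boundedAll ?_ hlen)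
  have hx : Computable fun z : (((List Bool × ℕ × ℕ) × ℕ) × ℕ × List Bool) × ℕ => z.1.1.1 :=
    Computable.fst.comp (Computable.fst.comp Computable.fst)
  have hp' : Computable fun z : (((List Bool × ℕ × ℕ) × ℕ) × ℕ × List Bool) × ℕ => z.1.2 :=
    Computable.snd.comp Computable.fst
  have hpos' := (hpos i).comp ((Computable.fst.comp (Computable.snd.comp hx)).pair
    ((Computable.fst.comp hp').pair Computable.snd))
  exact hand.comp (hlt.comp hpos' (Computable.snd.comp (Computable.snd.comp hx)))
    (heqB.comp (hgetD.comp (Computable.snd.comp hp') Computable.snd)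
      (hgetD.comp (Computable.fst.comp hx) hpos'))

/-- A bound for the coordinates of the first `t` indices enumerated by `d`. -/
def coordBound (d : ℕ → Fin k → ℕ) (t : ℕ) : ℕ :=
  Nat.rec 0 (fun j b => b + ∑ i, d j i) t

lemma le_coordBound (d : ℕ → Fin k → ℕ) {j t : ℕ} (hj : j < t) (i : Fin k) :
    d j i ≤ coordBound d t := by
  induction t with
  | zero => exact absurd hj (Nat.not_lt_zero j)
  | succ t ih =>
    change d j i ≤ coordBound d t + ∑ i, d t i
    rcases Nat.lt_succ_iff_lt_or_eq.1 hj with h | rfl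
    · exact (ih h).trans (Nat.le_add_right _ _)
    · exact (Finset.single_le_sum (fun _ _ => Nat.zero_le _) (Finset.mem_univ i)).trans
        (Nat.le_add_left _ _)

lemma computable_coordBound {d : ℕ → Fin k → ℕ} (hd : Computable d) :
    Computable (coordBound d) := by
  refine Computable.nat_rec (h := fun _ y => y.2 + ∑ i, d y.1 i) Computable.id
    (Computable.const 0) ?_
  have hy : Computable fun y : ℕ × ℕ × ℕ => y.2 := Computable.snd
  exact Primrec.nat_add.to_comp.comp (Computable.snd.comp hy)
    (Computable.finset_sum Finset.univ fun i =>
      Computable.fin_app.comp (hd.comp (Computable.fst.comp hy)) (Computable.const i))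

/-- The points which have not been removed from the class by the first `s` enumerated arrays. -/
def stageClass (f : ℕ → Option (ℕ × List Bool)) (s : ℕ) : Set ((Fin k → ℕ) → Bool) :=
  {Z | ∀ j < s, ∀ p, f j = some p → ¬ ArrayAgrees p.1 p.2 Z}

/-- The indices read by the first `s` enumerated arrays. -/
def stageIndices (f : ℕ → Option (ℕ × List Bool)) (s : ℕ) : Set (Fin k → ℕ) :=
  ⋃ j ∈ Set.Iio s, (indexBox k (((f j).map Prod.fst).getD 0) : Set (Fin k → ℕ))

lemma stageIndices_finite (f : ℕ → Option (ℕ × List Bool)) (s : ℕ) :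
    (stageIndices (k := k) f s).Finite :=
  (Set.finite_Iio s).biUnion fun _ _ => Finset.finite_toSet _

lemma stageClass_antitone (f : ℕ → Option (ℕ × List Bool)) :
    Antitone (stageClass (k := k) f) :=
  fun _ _ h _ hZ j hj => hZ j (hj.trans_le h)

lemma stageClass_congr {f : ℕ → Option (ℕ × List Bool)} {s : ℕ} {Z Z' : (Fin k → ℕ) → Bool}
    (h : ∀ u ∈ stageIndices f s, Z u = Z' u) (hZ : Z ∈ stageClass f s) :
    Z' ∈ stageClass f s := by
  refine fun j hj p hp hZ' => hZ j hj p hp (hZ'.congr fun u hu => (h u ?_).symm)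
  exact Set.mem_biUnion hj (by simpa [hp] using hu)

lemma iInter_stageClass (f : ℕ → Option (ℕ × List Bool)) :
    ⋂ s, stageClass (k := k) f s = (openClK {p | ∃ j, f j = some p})ᶜ := by
  ext Z
  simp only [Set.mem_iInter, Set.mem_compl_iff]
  constructor
  · rintro h ⟨p, ⟨j, hj⟩, hp⟩
    exact h (j + 1) j j.lt_succ_self p hj hp
  · exact fun h s j _ p hp hZ => h ⟨p, ⟨j, hp⟩, hZ⟩

lemma measurableSet_iInter_stageClass (f : ℕ → Option (ℕ × List Bool)) :
    MeasurableSet (⋂ s, stageClass (k := k) f s) :=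
  .iInter fun s => coordAlg_le _ _
    (measurableSet_coordAlg_of_finite (stageIndices_finite f s) fun _ _ => stageClass_congr)

lemma exists_pairwise_disjoint_shiftIndex {D : Set (Fin k → ℕ)} (hD : D.Finite)
    {e : (Fin k → ℕ) → ℕ} (he : Function.Injective e) :
    ∃ N₀, ∀ N ≥ N₀, Pairwise fun i j : Fin k =>
      Disjoint ((fun u => e (shiftIndex i N u)) '' D) ((fun u => e (shiftIndex j N u)) '' D) := by
  obtain ⟨b, hb⟩ := hD.bddAbove
  refine ⟨∑ i, b i + 1, fun N hN i j hij => Set.disjoint_left.2 ?_⟩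
  rintro _ ⟨u, -, rfl⟩ ⟨v, hv, huv⟩
  have h := congrFun (he huv) i
  simp only [shiftIndex, hij, if_true, if_false] at h
  have hvb : v i ≤ b i := hb hv i
  have := Finset.single_le_sum (f := b) (fun _ _ => Nat.zero_le _) (Finset.mem_univ i)
  omega

end Arrays

/-- Every Martin-Löf random point of `X_k = {0,1}^(ℕ^k)` (randomness being transported
from Cantor space along a computable bijection `ℕ^k ≃ ℕ`) is multiply recurrent in
every Π⁰₁ class `P ⊆ X_k` with `μ P > 0`. -/
theorem mlRandomK_multiplyRecurrent_pi01 (k : ℕ) (hk : 1 ≤ k)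
    (μ : Measure ((Fin k → ℕ) → Bool)) (hμ : IsUniformMeasureK μ)
    (ν : Measure (ℕ → Bool)) (hν : IsUniformMeasure ν)
    (P : Set ((Fin k → ℕ) → Bool)) (hP : Pi01ClassK P) (hPpos : 0 < μ P)
    (Z : (Fin k → ℕ) → Bool)
    (e : (Fin k → ℕ) ≃ ℕ) (he : Computable (fun u => e u))
    (he' : Computable (fun m => e.symm m))
    (hZ : MLRandom ν (fun m => Z (e.symm m))) :
    MultiplyRecurrentK P Z := by
  obtain ⟨S, ⟨f, hf, rfl⟩, rfl⟩ := hP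
  rw [hν.eq_coinMeasure] at hZ
  rw [hμ.eq_coinMeasure hk, ← iInter_stageClass] at hPpos
  have hinj (i : Fin k) (N : ℕ) : Function.Injective fun u => e (shiftIndex i N u) :=
    e.injective.comp (shiftIndex_injective i N)
  obtain ⟨c, hc0, N₀, hN₀⟩ := exists_pos_le_coinMeasure_iInter (stageClass_antitone f)
    (stageIndices f) (stageIndices_finite f) (fun s _ _ => stageClass_congr) hPpos.ne'
    (fun i N u => e (shiftIndex i N u)) hinj
    fun s => exists_pairwise_disjoint_shiftIndex (stageIndices_finite f s) e.injective
  let nf (l : ℕ) : ℕ := N₀ + 1 + coordBound (fun m => e.symm m) l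
  have hnf : Computable nf :=
    Primrec.nat_add.to_comp.comp (Computable.const (N₀ + 1)) (computable_coordBound he')
  let G (N : ℕ) : Set (ℕ → Bool) :=
    ⋂ i : Fin k, (fun W u => W (e (shiftIndex i N u))) ⁻¹' ⋂ s, stageClass f s
  have hGmem (N : ℕ) (W : ℕ → Bool) : W ∈ (G N)ᶜ ↔
      ∃ i : Fin k, (fun u => W (e (shiftIndex i N u))) ∈ openClK {p | ∃ j, f j = some p} := by
    simp [G, iInter_stageClass]
  have hG (l : ℕ) : MeasurableSet[coordAlg (Set.Ici l)] (G (nf l)) := by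
    refine @MeasurableSet.iInter _ _ (coordAlg _) _ _ fun i =>
      measurableSet_coordAlg_preimage (fun u => ?_) (measurableSet_iInter_stageClass f)
    by_contra hlt
    have h := le_coordBound (fun m => e.symm m) (not_le.1 hlt) i
    simp only [Equiv.symm_apply_apply, shiftIndex, if_true, nf] at h
    omega
  have hq (l : ℕ) (A : Set (ℕ → Bool)) (hA : MeasurableSet[coordAlg (Set.Iio l)] A) :
      coinMeasure ℕ (A ∩ (G (nf l))ᶜ) ≤ (1 - c) * coinMeasure ℕ A := by
    rw [coinMeasure_inter (Set.Iio_disjoint_Ici le_rfl) hA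
      (@MeasurableSet.compl _ _ (coordAlg _) (hG l)), mul_comm,
      prob_compl_eq_one_sub (coordAlg_le _ _ (hG l))]
    gcongr
    exact hN₀ _ (by simp only [nf]; omega)
  obtain ⟨m, hm⟩ := hZ.exists_count_lt (computable_arrayHit hf he) hnf
    (fun _ _ _ _ => arrayHit_congr) (fun W N t h => (hGmem N W).2 (arrayHit_sound h))
    (ENNReal.sub_lt_self ENNReal.one_ne_top one_ne_zero hc0) hq
  by_contra hrec
  have hbad (l : ℕ) : ∃ t₀, ∀ t ≥ t₀,
      arrayHit f e (fun m => Z (e.symm m)) (nf l) t = true := by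
    have hl : ¬ Z ∈ ⋂ i : Fin k, (shiftK i)^[nf l] ⁻¹' (openClK {p | ∃ j, f j = some p})ᶜ :=
      fun h => hrec ⟨nf l, by simp only [nf]; omega, h⟩
    simp only [Set.mem_iInter, Set.mem_preimage, Set.mem_compl_iff, not_forall, not_not,
      shiftK_iterate] at hl
    obtain ⟨i, hi⟩ := hl
    exact arrayHit_complete (i := i) (by simpa using hi)
  obtain ⟨t, ht⟩ := exists_le_count hbad m
  exact absurd (hm t) (not_lt.2 ht)
end

section
/- Let T₁, …, T_k be pairwise commuting computable measure-preserving transformations of Cantor space {0,1}^ℕ with the uniform measure λ, and let P ⊆ {0,1}^ℕ be a Π⁰₁ class with λ(P) > 0. If z ∈ P is weakly 2-random, then there is n ≥ 1 such that z ∈ ⋂_{1≤i≤k} T_i^{-n}(P). -/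
open MeasureTheory

/-- The length-`n` prefix of `Z`, as a finite binary string. -/
def prefixList (Z : ℕ → Bool) (n : ℕ) : List Bool := List.ofFn (fun i : Fin n => Z i)

/-- `T` is a computable map on Cantor space: there is an algorithm (a computable monotone
string function) that, given any desired output prefix length `m`, computes the first `m`
bits of `T Z` from finitely many bits of `Z`. -/
def ComputableMap (T : (ℕ → Bool) → (ℕ → Bool)) : Prop :=
  ∃ f : List Bool → List Bool, Computable f ∧
    (∀ σ τ : List Bool, σ <+: τ → f σ <+: f τ) ∧
    ∀ Z : ℕ → Bool, ∀ m : ℕ, ∃ n : ℕ,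
      m ≤ (f (prefixList Z n)).length ∧ IsPrefixOf (f (prefixList Z n)) (T Z)

/-- A generalized Martin-Löf test w.r.t. `μ`: uniformly c.e. open sets whose
intersection is null. -/
def GeneralizedMLTest (μ : MeasureTheory.Measure (ℕ → Bool)) (S : ℕ → Set (List Bool)) : Prop :=
  UniformlyCE S ∧ μ (⋂ m, openCl (S m)) = 0

/-- `Z` is weakly 2-random w.r.t. `μ`. -/
def Weak2Random (μ : MeasureTheory.Measure (ℕ → Bool)) (Z : ℕ → Bool) : Prop :=
  ∀ S : ℕ → Set (List Bool), GeneralizedMLTest μ S → ∃ m, Z ∉ openCl (S m)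

namespace DensityHJ

open scoped BigOperators

/-- The uniform average of a real function on a finite type. -/
noncomputable def avg {X : Type*} [Finite X] (f : X → ℝ) : ℝ :=
  letI := Fintype.ofFinite X
  𝔼 x, f x

/-- The real-valued indicator of a proposition. -/
noncomputable def ind (p : Prop) : ℝ :=
  letI := Classical.propDecidable p
  if p then 1 else 0

theorem ind_true {p : Prop} (h : p) : ind p = 1 := by simp [ind, h]

theorem ind_false {p : Prop} (h : ¬p) : ind p = 0 := by simp [ind, h]

theorem ind_nonneg (p : Prop) : 0 ≤ ind p := by
  unfold ind; split_ifs <;> norm_num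

theorem ind_le_one (p : Prop) : ind p ≤ 1 := by
  unfold ind; split_ifs <;> norm_num

theorem ind_mono {p q : Prop} (h : p → q) : ind p ≤ ind q := by
  by_cases hp : p
  · rw [ind_true hp, ind_true (h hp)]
  · rw [ind_false hp]; exact ind_nonneg q

section Average

variable {X Y : Type*} [Finite X] [Finite Y]

theorem avg_eq [Fintype X] (f : X → ℝ) : avg f = (∑ x, f x) / Fintype.card X := by
  unfold avg
  rw [← Fintype.expect_eq_sum_div_card]
  congr!

theorem avg_le_avg {f g : X → ℝ} (h : ∀ x, f x ≤ g x) : avg f ≤ avg g :=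
  Finset.expect_le_expect fun x _ => h x

theorem avg_add (f g : X → ℝ) : avg (fun x => f x + g x) = avg f + avg g :=
  Finset.expect_add_distrib _ _ _

theorem avg_sub (f g : X → ℝ) : avg (fun x => f x - g x) = avg f - avg g :=
  Finset.expect_sub_distrib _ _ _

theorem avg_const_mul (c : ℝ) (f : X → ℝ) : avg (fun x => c * f x) = c * avg f :=
  (Finset.mul_expect _ _ _).symm

theorem avg_sum {S : Type*} (s : Finset S) (f : S → X → ℝ) :
    avg (fun x => ∑ i ∈ s, f i x) = ∑ i ∈ s, avg (f i) :=
  Finset.expect_sum_comm _ _ _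

theorem avg_const [Nonempty X] (c : ℝ) : avg (fun _ : X => c) = c := by
  unfold avg; let := Fintype.ofFinite X; exact Fintype.expect_const c

theorem avg_comm (f : X → Y → ℝ) :
    avg (fun x => avg (fun y => f x y)) = avg (fun y => avg (fun x => f x y)) :=
  Finset.expect_comm _ _ _

theorem avg_equiv (e : X ≃ Y) (f : Y → ℝ) : avg (fun x => f (e x)) = avg f := by
  let := Fintype.ofFinite X
  let := Fintype.ofFinite Y
  exact Fintype.expect_equiv e _ _ fun _ => rfl

theorem avg_prod (f : X × Y → ℝ) : avg f = avg (fun x => avg (fun y => f (x, y))) := by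
  let := Fintype.ofFinite X
  let := Fintype.ofFinite Y
  rw [avg_eq, avg_eq]
  simp only [avg_eq]
  rw [Fintype.sum_prod_type, Fintype.card_prod, ← Finset.sum_div, div_div]
  push_cast
  ring

theorem avg_nonneg {f : X → ℝ} (h : ∀ x, 0 ≤ f x) : 0 ≤ avg f :=
  Finset.expect_nonneg fun x _ => h x

theorem avg_le [Nonempty X] {f : X → ℝ} {c : ℝ} (h : ∀ x, f x ≤ c) : avg f ≤ c :=
  (avg_le_avg h).trans_eq (avg_const c)

theorem exists_avg_le [Nonempty X] (f : X → ℝ) : ∃ x, avg f ≤ f x := by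
  by_contra! h
  let := Fintype.ofFinite X
  exact lt_irrefl _ (Finset.expect_lt (s := Finset.univ) (f := f) (fun x _ => (h x).le)
    ⟨Classical.arbitrary X, Finset.mem_univ _, h _⟩)

theorem avg_sum_elim {α ι κ : Type*} [Finite α] [Finite ι] [Finite κ] (f : (ι ⊕ κ → α) → ℝ) :
    avg f = avg (fun y : ι → α => avg (fun z : κ → α => f (Sum.elim y z))) := by
  rw [← avg_equiv (Equiv.sumArrowEquivProdArrow ι κ α).symm, avg_prod]
  rfl

/-- The range of an injective map has density the ratio of the cardinalities, and averaging over
the range is averaging over the source. -/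
theorem avg_ind_range {f : X → Y} (hf : Function.Injective f) [Nonempty X] (g : Y → ℝ) :
    avg (fun y => ind (y ∈ Set.range f) * g y) =
      (Nat.card X / Nat.card Y : ℝ) * avg (fun x => g (f x)) := by
  classical
  let := Fintype.ofFinite X
  let := Fintype.ofFinite Y
  rw [avg_eq, avg_eq, Nat.card_eq_fintype_card, Nat.card_eq_fintype_card]
  have : ∑ y, ind (y ∈ Set.range f) * g y = ∑ x, g (f x) := by
    rw [← Finset.sum_image (f := g) (s := Finset.univ) (g := f) (fun a _ b _ h => hf h)]
    symm
    rw [← Finset.sum_subset (Finset.subset_univ (Finset.univ.image f))]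
    · refine Finset.sum_congr rfl fun y hy => ?_
      rw [ind_true, one_mul]
      simpa using hy
    · intro y _ hy
      rw [ind_false, zero_mul]
      simpa using hy
  rw [this]
  have h0 : (Fintype.card X : ℝ) ≠ 0 := by simp
  field_simp

/-- If the mean is at least `c` and all values are at most `c + e`, no value is far below `c`. -/
theorem le_of_avg {f : X → ℝ} {c e : ℝ} (hf : ∀ x, f x ≤ c + e) (hc : c - e ≤ avg f)
    (x₀ : X) : c - 2 * Nat.card X * e + e ≤ f x₀ := by
  classical
  let := Fintype.ofFinite X
  have : Nonempty X := ⟨x₀⟩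
  rw [avg_eq, le_div_iff₀ (by exact_mod_cast Fintype.card_pos)] at hc
  rw [Nat.card_eq_fintype_card]
  rw [← Finset.add_sum_erase _ _ (Finset.mem_univ x₀)] at hc
  have h1 : ∑ x ∈ Finset.univ.erase x₀, f x ≤ (Fintype.card X - 1 : ℝ) * (c + e) := by
    refine (Finset.sum_le_card_nsmul _ _ (c + e) fun x _ => hf x).trans_eq ?_
    rw [Finset.card_erase_of_mem (Finset.mem_univ _), nsmul_eq_mul, Finset.card_univ,
      Nat.cast_sub Fintype.card_pos]
    simp
  nlinarith

end Average

/-- The density of a set in a finite type. -/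
noncomputable def dens {X : Type*} [Finite X] (A : Set X) : ℝ := avg fun x => ind (x ∈ A)

theorem dens_nonneg {X : Type*} [Finite X] (A : Set X) : 0 ≤ dens A :=
  avg_nonneg fun _ => ind_nonneg _

theorem dens_le_one {X : Type*} [Finite X] [Nonempty X] (A : Set X) : dens A ≤ 1 :=
  avg_le fun _ => ind_le_one _

theorem dens_le {X : Type*} [Finite X] {A B : Set X} (h : A ⊆ B) : dens A ≤ dens B :=
  avg_le_avg fun _ => ind_mono fun hx => h hx

theorem nonempty_of_dens_pos {X : Type*} [Finite X] {A : Set X} (h : 0 < dens A) : A.Nonempty := by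
  by_contra hA
  rw [Set.not_nonempty_iff_eq_empty] at hA
  subst hA
  have : dens (∅ : Set X) ≤ 0 := by
    refine (avg_le_avg (g := fun _ => 0) fun x => ?_).trans ?_
    · rw [ind_false (by simp)]
    · unfold avg; simp
  linarith

/-- If each point lying in `A` has a label `c` with `R c x`, some label has a large fibre. -/
theorem exists_dens_fiber {X C : Type*} [Finite X] [Finite C] {A : Set X}
    (hA : 0 < dens A) {R : C → X → Prop} (h : ∀ x ∈ A, ∃ c, R c x) :
    ∃ c, dens A / Nat.card C ≤ dens {x | R c x} := by
  classical
  let := Fintype.ofFinite C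
  obtain ⟨x, hx⟩ := nonempty_of_dens_pos hA
  obtain ⟨c₀, -⟩ := h x hx
  have : Nonempty C := ⟨c₀⟩
  by_contra! hc
  have h1 : dens A ≤ ∑ c, dens {x | R c x} := by
    unfold dens
    rw [← avg_sum]
    refine avg_le_avg fun x => ?_
    by_cases hx : x ∈ A
    · obtain ⟨c, hc⟩ := h x hx
      refine (ind_le_one _).trans ?_
      rw [← ind_true (show x ∈ {x | R c x} from hc)]
      exact Finset.single_le_sum (f := fun c => ind (x ∈ {x | R c x}))
        (fun _ _ => ind_nonneg _) (Finset.mem_univ c)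
    · rw [ind_false hx]; exact Finset.sum_nonneg fun _ _ => ind_nonneg _
  have h2 : ∑ c, dens {x | R c x} < ∑ _c : C, dens A / Nat.card C :=
    Finset.sum_lt_sum_of_nonempty Finset.univ_nonempty fun c _ => hc c
  rw [Finset.sum_const, Finset.card_univ, nsmul_eq_mul, Nat.card_eq_fintype_card] at h2
  have : (Fintype.card C : ℝ) ≠ 0 := by simp
  rw [mul_div_cancel₀ _ this] at h2
  linarith

/-- The combinatorial subspace coded by `φ`: coordinate `i` is either the constant `φ i` or a copy
of the parameter `φ i`. -/
def subspaceMap {α ι η : Type*} (φ : ι → α ⊕ η) (x : η → α) : ι → α :=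
  fun i => Sum.elim id x (φ i)

/-- Every parameter of `φ` occurs. -/
def Proper {α ι η : Type*} (φ : ι → α ⊕ η) : Prop := ∀ e, ∃ i, φ i = Sum.inr e

/-- Composition of codes of subspaces. -/
def compCode {α ι η ζ : Type*} (φ : ι → α ⊕ η) (ψ : η → α ⊕ ζ) : ι → α ⊕ ζ :=
  fun i => Sum.elim Sum.inl ψ (φ i)

/-- Enlarge the alphabet of a subspace by one letter. -/
def liftCode {α ι η : Type*} (φ : ι → α ⊕ η) : ι → Option α ⊕ η := fun i => Sum.map some id (φ i)

/-- Substitute the letter `a` for the symbol `none`. -/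
def subst {α ι : Type*} (a : α) (w : ι → Option α) : ι → α := fun i => (w i).getD a

/-- A word over `Option η` with given letter at `none`. -/
def consWord {α η : Type*} (a : α) (w : η → α) : Option η → α := fun o => o.elim a w

/-- `A` contains a combinatorial line. -/
def HasLine {α ι : Type*} (A : Set (ι → α)) : Prop :=
  ∃ w : ι → Option α, (∃ i, w i = none) ∧ ∀ a, subst a w ∈ A

section

variable {α ι η ζ : Type*}

theorem subspaceMap_comp (φ : ι → α ⊕ η) (ψ : η → α ⊕ ζ) (x : ζ → α) :
    subspaceMap (compCode φ ψ) x = subspaceMap φ (subspaceMap ψ x) := by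
  funext i
  unfold subspaceMap compCode
  rcases φ i with a | e <;> simp

theorem Proper.comp {φ : ι → α ⊕ η} {ψ : η → α ⊕ ζ} (hφ : Proper φ) (hψ : Proper ψ) :
    Proper (compCode φ ψ) := by
  intro e
  obtain ⟨j, hj⟩ := hψ e
  obtain ⟨i, hi⟩ := hφ j
  exact ⟨i, by simp [compCode, hi, hj]⟩

theorem liftCode_comp (φ : ι → α ⊕ η) (ψ : η → α ⊕ ζ) :
    liftCode (compCode φ ψ) = compCode (liftCode φ) (liftCode ψ) := by
  funext i
  rcases h : φ i with a | e <;> simp [liftCode, compCode, h]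

theorem Proper.lift {φ : ι → α ⊕ η} (hφ : Proper φ) : Proper (liftCode φ) := by
  intro e
  obtain ⟨i, hi⟩ := hφ e
  exact ⟨i, by simp [liftCode, hi]⟩

theorem subspaceMap_injective {φ : ι → α ⊕ η} (hφ : Proper φ) :
    Function.Injective (subspaceMap φ) := by
  intro x y h
  funext e
  obtain ⟨i, hi⟩ := hφ e
  simpa [subspaceMap, hi] using congrFun h i

theorem subst_liftCode (φ : ι → α ⊕ η) (a : α) (w : η → Option α) :
    subst a (subspaceMap (liftCode φ) w) = subspaceMap φ (subst a w) := by
  funext i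
  unfold subst subspaceMap liftCode
  rcases φ i with a | e <;> simp

theorem subspaceMap_liftCode_some (φ : ι → α ⊕ η) (w : η → α) :
    subspaceMap (liftCode φ) (fun i => some (w i)) = fun i => some (subspaceMap φ w i) := by
  funext i
  unfold subspaceMap liftCode
  rcases φ i with a | e <;> simp

theorem HasLine.of_subspace {φ : ι → α ⊕ η} (hφ : Proper φ) {A : Set (ι → α)}
    (h : HasLine {x | subspaceMap φ x ∈ A}) : HasLine A := by
  obtain ⟨w, ⟨e, he⟩, hw⟩ := h
  obtain ⟨i, hi⟩ := hφ e
  refine ⟨subspaceMap (liftCode φ) w, ⟨i, by simp [subspaceMap, liftCode, hi, he]⟩, fun a => ?_⟩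
  rw [subst_liftCode]
  exact hw a

theorem HasLine.mono {A B : Set (ι → α)} (h : HasLine A) (hAB : A ⊆ B) : HasLine B := by
  obtain ⟨w, hw, hA⟩ := h
  exact ⟨w, hw, fun a => hAB (hA a)⟩

/-- A subspace of the left factor, with the right coordinates fixed. -/
def leftCode {κ : Type*} (φ : ι → α ⊕ η) (z : κ → α) : ι ⊕ κ → α ⊕ η :=
  Sum.elim φ fun j => Sum.inl (z j)

/-- A subspace of the right factor, with the left coordinates fixed. -/
def rightCode {κ : Type*} (y : κ → α) (φ : ι → α ⊕ η) : κ ⊕ ι → α ⊕ η :=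
  Sum.elim (fun j => Sum.inl (y j)) φ

theorem Proper.left {κ : Type*} {φ : ι → α ⊕ η} (hφ : Proper φ) (z : κ → α) :
    Proper (leftCode φ z) := by
  intro e
  obtain ⟨i, hi⟩ := hφ e
  exact ⟨Sum.inl i, by simpa [leftCode] using hi⟩

theorem Proper.right {κ : Type*} {φ : ι → α ⊕ η} (hφ : Proper φ) (y : κ → α) :
    Proper (rightCode y φ) := by
  intro e
  obtain ⟨i, hi⟩ := hφ e
  exact ⟨Sum.inr i, by simpa [rightCode] using hi⟩

theorem subspaceMap_leftCode {κ : Type*} (φ : ι → α ⊕ η) (z : κ → α) (x : η → α) :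
    subspaceMap (leftCode φ z) x = Sum.elim (subspaceMap φ x) z := by
  funext i
  rcases i with i | j <;> simp [subspaceMap, leftCode]

theorem subspaceMap_rightCode {κ : Type*} (φ : ι → α ⊕ η) (y : κ → α) (x : η → α) :
    subspaceMap (rightCode y φ) x = Sum.elim y (subspaceMap φ x) := by
  funext i
  rcases i with i | j <;> simp [subspaceMap, rightCode]

theorem proper_inr : Proper (Sum.inr : η → α ⊕ η) := fun e => ⟨e, rfl⟩

theorem subspaceMap_inr (x : η → α) : subspaceMap (Sum.inr : η → α ⊕ η) x = x := rfl

end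

/-- Code obtained from a subspace over `Option α` by reading the constant `none` as a new first
parameter, which also occurs at a new first coordinate. -/
def absorbCode {α ι η : Type*} (V : ι → Option α ⊕ η) : Option ι → α ⊕ Option η :=
  fun o => o.elim (Sum.inr none) fun i =>
    Sum.elim (fun b => b.elim (Sum.inr none) Sum.inl) (fun e => Sum.inr (some e)) (V i)

theorem Proper.absorb {α ι η : Type*} {V : ι → Option α ⊕ η} (hV : Proper V) :
    Proper (absorbCode V) := by
  rintro (_ | e)
  · exact ⟨none, rfl⟩
  · obtain ⟨i, hi⟩ := hV e
    exact ⟨some i, by simp [absorbCode, hi]⟩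

theorem subspaceMap_absorbCode {α ι η : Type*} (V : ι → Option α ⊕ η) (w : η → Option α) :
    subspaceMap (liftCode (absorbCode V)) (consWord none w) = consWord none (subspaceMap V w) := by
  funext o
  rcases o with _ | i
  · simp [subspaceMap, liftCode, absorbCode, consWord]
  · rcases h : V i with (_ | a) | e <;> simp [subspaceMap, liftCode, absorbCode, consWord, h]

/-- Prepend one parameter to a code. -/
def consCode {α ι η : Type*} (φ : ι → α ⊕ η) : Option ι → α ⊕ Option η :=
  fun o => o.elim (Sum.inr none) fun i => Sum.map id some (φ i)

/-- Prepend one constant to a code. -/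
def constCode {α ι η : Type*} (a : α) (φ : ι → α ⊕ η) : Option ι → α ⊕ η :=
  fun o => o.elim (Sum.inl a) φ

theorem Proper.cons {α ι η : Type*} {φ : ι → α ⊕ η} (h : Proper φ) : Proper (consCode φ) := by
  rintro (_ | e)
  · exact ⟨none, rfl⟩
  · obtain ⟨i, hi⟩ := h e
    exact ⟨some i, by simp [consCode, hi]⟩

theorem Proper.const {α ι η : Type*} {φ : ι → α ⊕ η} (h : Proper φ) (a : α) :
    Proper (constCode a φ) := fun e => by
  obtain ⟨i, hi⟩ := h e
  exact ⟨some i, by simpa [constCode] using hi⟩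

theorem subspaceMap_consCode {α ι η : Type*} (φ : ι → α ⊕ η) (w : Option η → Option α) :
    subspaceMap (liftCode (consCode φ)) w =
      consWord (w none) (subspaceMap (liftCode φ) fun e => w (some e)) := by
  funext o
  rcases o with _ | i
  · simp [subspaceMap, liftCode, consCode, consWord]
  · rcases h : φ i with a | e <;> simp [subspaceMap, liftCode, consCode, consWord, h]

theorem subspaceMap_constCode {α ι η : Type*} (a : α) (φ : ι → α ⊕ η) (w : η → Option α) :
    subspaceMap (liftCode (constCode a φ)) w = consWord (some a) (subspaceMap (liftCode φ) w) := by
  funext o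
  rcases o with _ | i
  · simp [subspaceMap, liftCode, constCode, consWord]
  · rcases h : φ i with a | e <;> simp [subspaceMap, liftCode, constCode, consWord, h]

/-- A weak Graham–Rothschild theorem: for any finite family of properties of words with wildcard
`none`, either one property holds for all variable words beginning with the first parameter of
some large subspace, or all properties fail on all variable words of some `j`-dimensional one. -/
theorem exists_subspace_of_properties (α : Type) [Finite α] (η : Type) [Finite η] (j : ℕ) :
    ∀ (S : Type) [Finite S], ∃ (ι : Type) (_ : Finite ι), ∀ G : S → (ι → Option α) → Prop,
      (∃ s, ∃ φ : ι → α ⊕ Option η, Proper φ ∧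
        ∀ w : η → Option α, G s (subspaceMap (liftCode φ) (consWord none w))) ∨
      ∃ ψ : ι → α ⊕ Fin j, Proper ψ ∧ ∀ s, ∀ w : Fin j → Option α, (∃ i, w i = none) →
        ¬G s (subspaceMap (liftCode ψ) w) := by
  induction j with
  | zero =>
    intro S _
    refine ⟨Empty, inferInstance, fun G => Or.inr ⟨fun i => i.elim, fun e => e.elim0, ?_⟩⟩
    rintro s w ⟨i, -⟩
    exact i.elim0
  | succ j ih =>
    intro S _
    obtain ⟨κ, _, hκ⟩ := ih (S × α)
    obtain ⟨N, _, hN⟩ := Combinatorics.Subspace.exists_mono_in_high_dimension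
      (α := Option α) (κ := S → Prop) (η := κ ⊕ η)
    refine ⟨Option N, inferInstance, fun G => ?_⟩
    obtain ⟨l, c, hc⟩ := hN fun w s => G s (consWord none w)
    have hl : Proper l.idxFun := l.proper
    have hlc : ∀ s w, G s (consWord none (subspaceMap l.idxFun w)) = c s :=
      fun s w => congrFun (hc w) s
    by_cases hcs : ∃ s, c s
    · obtain ⟨s, hs⟩ := hcs
      refine Or.inl ⟨s, compCode (absorbCode l.idxFun)
        (fun o => o.elim (Sum.inr none) (Sum.elim (fun _ => Sum.inr none)
          fun e => Sum.inr (some e))), hl.absorb.comp ?_, fun w => ?_⟩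
      · rintro (_ | e)
        · exact ⟨none, rfl⟩
        · exact ⟨some (Sum.inr e), rfl⟩
      · rw [liftCode_comp, subspaceMap_comp]
        have : subspaceMap (liftCode (fun o : Option (κ ⊕ η) => (o.elim (Sum.inr none)
            (Sum.elim (fun _ => Sum.inr none) fun e => Sum.inr (some e)) : α ⊕ Option η)))
            (consWord none w) = consWord none (Sum.elim (fun _ => none) w) := by
          funext o
          rcases o with _ | _ | e <;> simp [subspaceMap, liftCode, consWord]
        rw [this, subspaceMap_absorbCode, hlc]
        exact hs
    · push Not at hcs
      obtain ⟨φ, hφ, hbad⟩ : ∃ φ : Option N → α ⊕ Option κ, Proper φ ∧ ∀ s, ∀ w : κ → Option α,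
          ¬G s (subspaceMap (liftCode φ) (consWord none w)) := by
        refine ⟨compCode (absorbCode l.idxFun)
          (fun o => o.elim (Sum.inr none) (Sum.elim (fun e => Sum.inr (some e))
            fun _ => Sum.inr none)), hl.absorb.comp ?_, fun s w => ?_⟩
        · rintro (_ | e)
          · exact ⟨none, rfl⟩
          · exact ⟨some (Sum.inl e), rfl⟩
        · rw [liftCode_comp, subspaceMap_comp]
          have : subspaceMap (liftCode (fun o : Option (κ ⊕ η) => (o.elim (Sum.inr none)
              (Sum.elim (fun e => Sum.inr (some e)) fun _ => Sum.inr none) : α ⊕ Option κ)))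
              (consWord none w) = consWord none (Sum.elim w (fun _ => none)) := by
            funext o
            rcases o with _ | _ | e <;> simp [subspaceMap, liftCode, consWord]
          rw [this, subspaceMap_absorbCode, hlc]
          exact hcs s
      rcases hκ fun sa w => G sa.1 (subspaceMap (liftCode φ) (consWord (some sa.2) w)) with
        ⟨⟨s, a⟩, φ', hφ', hG⟩ | ⟨ψ, hψ, hG⟩
      · refine Or.inl ⟨s, compCode φ (constCode a φ'), hφ.comp (hφ'.const a), fun w => ?_⟩
        rw [liftCode_comp, subspaceMap_comp, subspaceMap_constCode]
        exact hG w
      · let e : Option (Fin j) → α ⊕ Fin (j + 1) := fun o => o.elim (Sum.inr 0) fun i =>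
          Sum.inr i.succ
        have he : Proper e := by
          intro i
          induction i using Fin.cases with
          | zero => exact ⟨none, rfl⟩
          | succ i => exact ⟨some i, rfl⟩
        refine Or.inr ⟨compCode (compCode φ (consCode ψ)) e, (hφ.comp hψ.cons).comp he, ?_⟩
        intro s w hw
        rw [liftCode_comp, subspaceMap_comp, liftCode_comp, subspaceMap_comp,
          subspaceMap_consCode]
        have h0 : subspaceMap (liftCode e) w none = w 0 := rfl
        have h1 : (fun i => subspaceMap (liftCode e) w (some i)) = fun i => w i.succ := rfl
        rw [h0, h1]
        rcases hw0 : w 0 with _ | a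
        · exact hbad s _
        · refine hG (s, a) _ ?_
          obtain ⟨i, hi⟩ := hw
          induction i using Fin.cases with
          | zero => simp [hw0] at hi
          | succ i => exact ⟨i, hi⟩

/-- Dense subsets of some `ι → α`, of density at least `δ`, contain combinatorial lines. -/
def DHJAt (α : Type) [Finite α] (δ : ℝ) : Prop :=
  ∃ (ι : Type) (_ : Finite ι), ∀ A : Set (ι → α), δ ≤ dens A → HasLine A

/-- The density Hales–Jewett property of an alphabet. -/
def DHJ (α : Type) [Finite α] : Prop := ∀ δ > 0, DHJAt α δ

/-- `D` is closed under exchanging the letters `a` and `none`. -/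
def Insensitive {α ι : Type*} (a : α) (D : Set (ι → Option α)) : Prop :=
  ∀ w w' : ι → Option α, subst a w = subst a w' → (w ∈ D ↔ w' ∈ D)

theorem Insensitive.preimage {α ι η : Type*} {a : α} {D : Set (ι → Option α)}
    (h : Insensitive a D) (φ : ι → Option α ⊕ η) : Insensitive a {w | subspaceMap φ w ∈ D} := by
  intro w w' hw
  refine h _ _ ?_
  funext i
  rcases hi : φ i with b | e
  · simp [subst, subspaceMap, hi]
  · simpa [subst, subspaceMap, hi] using congrFun hw e

section

variable {α : Type} [Finite α]

theorem DHJ.exists_line_avg (h : DHJ α) {δ : ℝ} (hδ : 0 < δ) :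
    ∃ (ι : Type) (_ : Finite ι), ∃ θ : ℝ, 0 < θ ∧ ∀ (Ω : Type) [Finite Ω] [Nonempty Ω]
      (E : (ι → α) → Set Ω), δ ≤ avg (fun y => dens (E y)) →
      ∃ w : ι → Option α, (∃ i, w i = none) ∧ θ ≤ dens {ω | ∀ a, ω ∈ E (subst a w)} := by
  obtain ⟨ι, _, hι⟩ := h (δ / 2) (by positivity)
  have : (0 : ℝ) < Nat.card (ι → Option α) := by exact_mod_cast Nat.card_pos
  refine ⟨ι, inferInstance, δ / 2 / Nat.card (ι → Option α), by positivity, ?_⟩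
  intro Ω _ _ E hE
  set O : Set Ω := {ω | δ / 2 ≤ dens {y | ω ∈ E y}} with hO
  have hOd : δ / 2 ≤ dens O := by
    have h1 : δ ≤ avg (fun ω => ind (ω ∈ O) + δ / 2) := by
      refine hE.trans ?_
      unfold dens
      rw [avg_comm]
      refine avg_le_avg fun ω => ?_
      by_cases hω : ω ∈ O
      · rw [ind_true hω]
        have : avg (fun y => ind (ω ∈ E y)) ≤ avg (fun y : ι → α => 1) :=
          avg_le_avg fun y => ind_le_one _
        have h2 : avg (fun _ : ι → α => (1 : ℝ)) ≤ 1 := by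
          rcases isEmpty_or_nonempty (ι → α) with h0 | h0
          · unfold avg; simp
          · exact (avg_const 1).le
        linarith
      · rw [ind_false hω, zero_add]
        exact (not_le.mp hω).le
    rw [avg_add, avg_const] at h1
    unfold dens
    linarith
  obtain ⟨w, hw⟩ := exists_dens_fiber (A := O) (by linarith)
    (R := fun (w : ι → Option α) ω => (∃ i, w i = none) ∧ ∀ a, ω ∈ E (subst a w))
    (fun ω hω => hι _ hω)
  have hle : δ / 2 / Nat.card (ι → Option α) ≤
      dens {ω | (∃ i, w i = none) ∧ ∀ a, ω ∈ E (subst a w)} := by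
    refine le_trans ?_ hw
    gcongr
  obtain ⟨ω, hω⟩ := nonempty_of_dens_pos (lt_of_lt_of_le (by positivity) hle)
  exact ⟨w, hω.1, hle.trans (dens_le fun ω hω => hω.2)⟩

/-- The multidimensional density Hales–Jewett theorem follows from the one for lines. -/
theorem DHJ.exists_subspace [Nonempty α] (h : DHJ α) (d : ℕ) : ∀ {δ : ℝ}, 0 < δ →
    ∃ (ι : Type) (_ : Finite ι), ∀ A : Set (ι → α), δ ≤ dens A →
      ∃ φ : ι → α ⊕ Fin d, Proper φ ∧ ∀ x, subspaceMap φ x ∈ A := by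
  induction d with
  | zero =>
    intro δ hδ
    refine ⟨Empty, inferInstance, fun A hA => ⟨fun i => i.elim, fun e => e.elim0, fun x => ?_⟩⟩
    obtain ⟨y, hy⟩ := nonempty_of_dens_pos (hδ.trans_le hA)
    convert hy
  | succ d ih =>
    intro δ hδ
    obtain ⟨ι, _, θ, hθ, hι⟩ := h.exists_line_avg hδ
    obtain ⟨κ, _, hκ⟩ := ih hθ
    refine ⟨ι ⊕ κ, inferInstance, fun A hA => ?_⟩
    unfold dens at hA
    rw [avg_sum_elim] at hA
    obtain ⟨w, ⟨i₀, hi₀⟩, hw⟩ := hι (κ → α) (fun y => {z | Sum.elim y z ∈ A}) hA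
    obtain ⟨φ, hφ, hφA⟩ := hκ _ hw
    refine ⟨Sum.elim (fun i => (w i).elim (Sum.inr 0) Sum.inl)
      (fun j => Sum.map id Fin.succ (φ j)), ?_, fun x => ?_⟩
    · intro e
      induction e using Fin.cases with
      | zero => exact ⟨Sum.inl i₀, by simp [hi₀]⟩
      | succ e =>
        obtain ⟨j, hj⟩ := hφ e
        exact ⟨Sum.inr j, by simp [hj]⟩
    · have key : subspaceMap (Sum.elim (fun i => (w i).elim (Sum.inr 0) Sum.inl)
          (fun j => Sum.map id Fin.succ (φ j))) x =
          Sum.elim (subst (x 0) w) (subspaceMap φ fun e => x e.succ) := by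
        funext o
        rcases o with i | j
        · rcases hi : w i with _ | a <;> simp [subspaceMap, subst, hi]
        · rcases hj : φ j with a | e <;> simp [subspaceMap, hj]
      rw [key]
      exact hφA _ (x 0)

theorem DHJ.exists_subspace_of_card [Nonempty α] (h : DHJ α) (ζ : Type) [Finite ζ] {δ : ℝ}
    (hδ : 0 < δ) : ∃ n : ℕ, ∀ (κ : Type) [Finite κ], n ≤ Nat.card κ →
      ∀ A : Set (κ → α), δ ≤ dens A → ∃ φ : κ → α ⊕ ζ, Proper φ ∧ ∀ x, subspaceMap φ x ∈ A := by
  classical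
  obtain ⟨ι, _, hι⟩ := h.exists_subspace (Nat.card ζ) hδ
  refine ⟨Nat.card ι, fun κ _ hcard A hA => ?_⟩
  have ez : ζ ≃ Fin (Nat.card ζ) := Finite.equivFin ζ
  obtain ⟨f⟩ : Nonempty (ι ↪ κ) := by
    let := Fintype.ofFinite ι
    let := Fintype.ofFinite κ
    rw [Nat.card_eq_fintype_card, Nat.card_eq_fintype_card] at hcard
    exact Function.Embedding.nonempty_of_card_le hcard
  let e : ι ⊕ ↥(Set.range f)ᶜ ≃ κ :=
    (Equiv.sumCongr (Equiv.ofInjective f f.injective) (Equiv.refl _)).trans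
      (Equiv.Set.sumCompl (Set.range f))
  unfold dens at hA
  rw [← avg_equiv (Equiv.arrowCongr e (Equiv.refl α)), avg_sum_elim, avg_comm] at hA
  obtain ⟨z, hz⟩ := exists_avg_le fun z : ↥(Set.range f)ᶜ → α => avg fun y : ι → α =>
    ind ((Equiv.arrowCongr e (Equiv.refl α)) (Sum.elim y z) ∈ A)
  obtain ⟨φ, hφ, hφA⟩ := hι {y | (Equiv.arrowCongr e (Equiv.refl α)) (Sum.elim y z) ∈ A}
    (hA.trans hz)
  refine ⟨fun k => Sum.map id ez.symm (leftCode φ z (e.symm k)), fun c => ?_, fun x => ?_⟩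
  · obtain ⟨i, hi⟩ := hφ (ez c)
    exact ⟨e (Sum.inl i), by simp [leftCode, hi]⟩
  · have key : subspaceMap (fun k => Sum.map id ez.symm (leftCode φ z (e.symm k))) x =
        (Equiv.arrowCongr e (Equiv.refl α))
          (Sum.elim (subspaceMap φ fun i => x (ez.symm i)) z) := by
      rw [← subspaceMap_leftCode]
      funext k
      rcases hk : leftCode φ z (e.symm k) with a | i <;> simp [subspaceMap, hk]
    rw [key]
    exact hφA _

/-- Exchange the visible letters of `u` with those of `y`. -/
def exchange {M : Type*} : (M → Option α) × (M → α) ≃ (M → Option α) × (M → α) where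
  toFun p := (fun j => (p.1 j).map fun _ => p.2 j, fun j => (p.1 j).getD (p.2 j))
  invFun p := (fun j => (p.1 j).map fun _ => p.2 j, fun j => (p.1 j).getD (p.2 j))
  left_inv := by
    rintro ⟨u, y⟩
    ext j
    · rcases h : u j with _ | b <;> simp [h]
    · rcases h : u j with _ | b <;> simp [h]
  right_inv := by
    rintro ⟨u, y⟩
    ext j
    · rcases h : u j with _ | b <;> simp [h]
    · rcases h : u j with _ | b <;> simp [h]

theorem avg_exchange [Nonempty α] {M : Type*} [Finite M] (f : (M → Option α) → ℝ) :
    avg f = avg fun u : M → Option α => avg fun y : M → α => f fun j => (u j).map fun _ => y j := by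
  have h1 : avg f = avg fun p : (M → Option α) × (M → α) => f p.1 := by
    rw [avg_prod]
    simp only [avg_const]
  rw [h1, ← avg_equiv exchange, avg_prod]
  rfl

theorem avg_prod_pow {X : Type*} [Finite X] (g : X → ℝ) (n : ℕ) :
    avg (fun u : Fin n → X => ∏ j, g (u j)) = avg g ^ n := by
  classical
  let := Fintype.ofFinite X
  rw [avg_eq, avg_eq, div_pow, Fintype.sum_pow]
  simp

/-- Few words have fewer than `n` visible letters. -/
theorem exists_dens_few_letters_lt [Nonempty α] (n : ℕ) {σ : ℝ} (hσ : 0 < σ) :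
    ∃ M : ℕ, dens {u : Fin M → Option α | Nat.card {j // u j ≠ none} < n} < σ := by
  classical
  let := Fintype.ofFinite α
  let g : Option α → ℝ := fun b => if b = none then 1 else 1 / 2
  have hg : avg g < 1 := by
    rw [avg_eq, div_lt_one (by positivity), Fintype.sum_option, Fintype.card_option]
    have : (0 : ℝ) < Fintype.card α := by exact_mod_cast Fintype.card_pos
    simp [g]
    linarith
  have hg0 : 0 ≤ avg g := avg_nonneg fun b => by simp only [g]; split_ifs <;> norm_num
  obtain ⟨M, hM⟩ := exists_pow_lt_of_lt_one (show 0 < σ / 2 ^ n by positivity) hg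
  refine ⟨M, ?_⟩
  have hle : dens {u : Fin M → Option α | Nat.card {j // u j ≠ none} < n} ≤
      avg fun u : Fin M → Option α => 2 ^ n * ∏ j, g (u j) := by
    refine avg_le_avg fun u => ?_
    have hp : ∏ j, g (u j) = (1 / 2 : ℝ) ^ Nat.card {j // u j ≠ none} := by
      rw [Nat.card_eq_fintype_card, Fintype.card_subtype]
      simp only [g]
      rw [Finset.prod_ite]
      simp
    rw [hp]
    by_cases hu : Nat.card {j // u j ≠ none} < n
    · rw [ind_true (by exact hu)]
      have : (1 / 2 : ℝ) ^ n ≤ (1 / 2 : ℝ) ^ Nat.card {j // u j ≠ none} :=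
        pow_le_pow_of_le_one (by norm_num) (by norm_num) hu.le
      calc (1 : ℝ) = 2 ^ n * (1 / 2) ^ n := by rw [← mul_pow]; norm_num
        _ ≤ _ := by gcongr
    · rw [ind_false (by exact hu)]; positivity
  rw [avg_const_mul, avg_prod_pow] at hle
  refine hle.trans_lt ?_
  rw [lt_div_iff₀ (by positivity)] at hM
  linarith

/-- Dense insensitive sets contain large subspaces. -/
theorem DHJ.exists_subspace_insensitive [Nonempty α] (h : DHJ α) (a : α) (ζ : Type) [Finite ζ]
    {σ : ℝ} (hσ : 0 < σ) : ∃ (κ : Type) (_ : Finite κ), ∀ E : Set (κ → Option α),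
      Insensitive a E → σ ≤ dens E →
      ∃ φ : κ → Option α ⊕ ζ, Proper φ ∧ ∀ x, subspaceMap φ x ∈ E := by
  classical
  obtain ⟨n, hn⟩ := h.exists_subspace_of_card ζ (half_pos hσ)
  obtain ⟨M, hM⟩ := exists_dens_few_letters_lt (α := α) n (half_pos hσ)
  refine ⟨Fin M, inferInstance, fun E hE hd => ?_⟩
  obtain ⟨u, hu⟩ := exists_avg_le fun u : Fin M → Option α =>
    (avg fun y : Fin M → α => ind ((fun j => (u j).map fun _ => y j) ∈ E)) -
      ind (u ∈ {u : Fin M → Option α | Nat.card {j // u j ≠ none} < n})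
  rw [avg_sub, ← avg_exchange fun w => ind (w ∈ E)] at hu
  change dens E - dens _ ≤ _ at hu
  have hu' : σ / 2 < (avg fun y : Fin M → α => ind ((fun j => (u j).map fun _ => y j) ∈ E)) -
      ind (u ∈ {u : Fin M → Option α | Nat.card {j // u j ≠ none} < n}) := by linarith
  have hle1 : (avg fun y : Fin M → α => ind ((fun j => (u j).map fun _ => y j) ∈ E)) ≤ 1 :=
    avg_le fun _ => ind_le_one _
  have hcard : n ≤ Nat.card {j // u j ≠ none} := by
    by_contra hlt
    rw [ind_true (by exact not_le.mp hlt)] at hu'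
    linarith
  rw [ind_false (by exact not_lt.mpr hcard), sub_zero] at hu'
  let F : ({j // u j ≠ none} → α) → Fin M → Option α := fun y j =>
    if hj : u j ≠ none then some (y ⟨j, hj⟩) else none
  have hF : (avg fun y : Fin M → α => ind ((fun j => (u j).map fun _ => y j) ∈ E)) =
      dens {y | F y ∈ E} := by
    rw [← avg_equiv (Equiv.piEquivPiSubtypeProd (fun j => u j ≠ none) (fun _ => α)).symm, avg_prod]
    unfold dens
    congr 1
    funext y
    rw [← avg_const (X := {j // ¬(u j ≠ none)} → α) (ind (y ∈ {y | F y ∈ E}))]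
    congr 1
    funext z
    congr 1
    have : (fun j => Option.map (fun _ => (Equiv.piEquivPiSubtypeProd (fun j => u j ≠ none)
        (fun _ => α)).symm (y, z) j) (u j)) = F y := by
      funext j
      rcases hj : u j with _ | b
      · simp [F, hj]
      · simp [F, hj, Equiv.piEquivPiSubtypeProd]
    rw [this]
    rfl
  rw [hF] at hu'
  obtain ⟨φ, hφ, hφE⟩ := hn _ hcard _ hu'.le
  refine ⟨fun j => if hj : u j ≠ none then liftCode φ ⟨j, hj⟩ else Sum.inl none, fun e => ?_,
    fun x => ?_⟩
  · obtain ⟨⟨j, hj⟩, hje⟩ := hφ e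
    refine ⟨j, ?_⟩
    simp [hj, liftCode, hje]
  · refine (hE _ _ ?_).mp (hφE (subst a x))
    funext j
    by_cases hj : u j = none
    · simp [F, subst, subspaceMap, hj]
    · rcases hφj : φ ⟨j, hj⟩ with b | e <;> simp [F, subst, subspaceMap, hj, hφj, liftCode]

end

section

variable {α : Type} [Finite α]

theorem Insensitive.left {α ι κ : Type*} {a : α} {D : Set (κ ⊕ ι → Option α)}
    (h : Insensitive a D) (z : ι → Option α) : Insensitive a {y | Sum.elim y z ∈ D} := by
  intro w w' hw
  refine h _ _ ?_
  funext o
  rcases o with i | j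
  · simpa [subst] using congrFun hw i
  · simp [subst]

theorem Insensitive.fiber_eq {α ι κ : Type*} {a : α} {D : Set (κ ⊕ ι → Option α)}
    (h : Insensitive a D) {z z' : ι → Option α} (hz : subst a z = subst a z') :
    {y : κ → Option α | Sum.elim y z ∈ D} = {y | Sum.elim y z' ∈ D} := by
  ext w
  refine h _ _ ?_
  funext o
  rcases o with i | j
  · simp [subst]
  · simpa [subst] using congrFun hz j

theorem avg_ind_insensitive_le_aux {a : α} {ζ κ : Type} [Finite ζ] [Finite κ] {σ τ c : ℝ}
    (hσ : 0 < σ) (hτ : 0 ≤ τ)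
    (hc : c = Nat.card (ζ → Option α) / Nat.card (κ → Option α)) (hc1 : c ≤ 1)
    (hκ : ∀ E : Set (κ → Option α), Insensitive a E → σ ≤ dens E →
      ∃ φ : κ → Option α ⊕ ζ, Proper φ ∧ ∀ x, subspaceMap φ x ∈ E) (R : ℕ) :
    ∃ (ι : Type) (_ : Finite ι), ∀ D : Set (ι → Option α), Insensitive a D →
      ∀ H : (ι → Option α) → ℝ, (∀ w, H w ≤ 1) →
        (∀ φ : ι → Option α ⊕ ζ, Proper φ → avg (fun x => H (subspaceMap φ x)) ≤ τ) →
        avg (fun w => ind (w ∈ D) * H w) ≤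
          τ * dens D + (1 - c) ^ R * dens D + (1 - (1 - c) ^ R) * σ := by
  classical
  induction R with
  | zero =>
    refine ⟨Empty, inferInstance, fun D _ H hH _ => ?_⟩
    have : avg (fun w => ind (w ∈ D) * H w) ≤ dens D :=
      avg_le_avg fun w => by nlinarith [hH w, ind_nonneg (w ∈ D)]
    have h0 : 0 ≤ τ * dens D := mul_nonneg hτ (dens_nonneg D)
    simp
    linarith
  | succ R ih =>
    obtain ⟨ι, _, hι⟩ := ih
    refine ⟨κ ⊕ ι, inferInstance, fun D hD H hH hHφ => ?_⟩
    have hc0 : 0 ≤ c := by rw [hc]; positivity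
    have hv : ∀ E : Set (κ → Option α), ∃ v ⊆ E, Insensitive a E →
        c * (dens E - σ) ≤ dens v ∧ ∀ g : (κ → Option α) → ℝ,
          (∀ φ : κ → Option α ⊕ ζ, Proper φ → avg (fun x => g (subspaceMap φ x)) ≤ τ) →
          avg (fun y => ind (y ∈ v) * g y) ≤ τ * dens v := by
      intro E
      by_cases hE : Insensitive a E ∧ σ ≤ dens E
      · obtain ⟨φ, hφ, hφE⟩ := hκ E hE.1 hE.2
        have hd : dens (Set.range (subspaceMap φ)) = c := by
          have := avg_ind_range (subspaceMap_injective hφ) fun _ => 1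
          simp only [mul_one, avg_const] at this
          rw [hc]
          exact this
        refine ⟨Set.range (subspaceMap φ), ?_, fun _ => ⟨?_, fun g hg => ?_⟩⟩
        · rintro _ ⟨x, rfl⟩
          exact hφE x
        · rw [hd]
          nlinarith [dens_le_one E]
        · rw [avg_ind_range (subspaceMap_injective hφ), ← hc, hd, mul_comm τ]
          exact mul_le_mul_of_nonneg_left (hg φ hφ) hc0
      · refine ⟨∅, Set.empty_subset _, fun hE' => ?_⟩
        have hd : dens (∅ : Set (κ → Option α)) = 0 := by
          simp [dens, ind_false, avg_const]
        rw [hd]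
        refine ⟨?_, fun g _ => ?_⟩
        · have : dens E < σ := by
            by_contra h
            exact hE ⟨hE', not_lt.mp h⟩
          nlinarith
        · simp [ind_false, avg_const]
    choose v hvE hv using hv
    let fib : (ι → Option α) → Set (κ → Option α) := fun z => {y | Sum.elim y z ∈ D}
    let D' : (κ → Option α) → Set (ι → Option α) := fun y => {z | y ∈ fib z ∧ y ∉ v (fib z)}
    have hsplit : ∀ y z, ind (Sum.elim y z ∈ D) = ind (y ∈ v (fib z)) + ind (z ∈ D' y) := by
      intro y z
      by_cases h1 : y ∈ v (fib z)
      · have h2 : Sum.elim y z ∈ D := hvE (fib z) h1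
        rw [ind_true h1, ind_true h2, ind_false (by simp [D', h1]), add_zero]
      · by_cases h2 : Sum.elim y z ∈ D
        · rw [ind_false h1, ind_true h2, ind_true (show z ∈ D' y from ⟨h2, h1⟩), zero_add]
        · rw [ind_false h1, ind_false h2, ind_false (fun h : z ∈ D' y => h2 h.1), zero_add]
    have hD' : ∀ y, Insensitive a (D' y) := by
      intro y z z' hz
      have : fib z = fib z' := hD.fiber_eq hz
      simp only [D', Set.mem_ofPred_eq, this]
    have hdens : dens D = avg (fun z => dens (v (fib z))) + avg (fun y => dens (D' y)) := by
      unfold dens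
      rw [avg_sum_elim, avg_comm (fun z y => ind (y ∈ v (fib z))), ← avg_add]
      congr 1
      funext y
      rw [← avg_add]
      simp only [hsplit]
    have hV : c * (dens D - σ) ≤ avg (fun z => dens (v (fib z))) := by
      have : c * (dens D - σ) = avg fun z => c * (dens (fib z) - σ) := by
        rw [avg_const_mul, avg_sub, avg_const]
        unfold dens
        rw [avg_sum_elim, avg_comm]
        rfl
      rw [this]
      exact avg_le_avg fun z => (hv _ (hD.left z)).1
    have h1 : avg (fun z => avg fun y => ind (y ∈ v (fib z)) * H (Sum.elim y z)) ≤
        τ * avg (fun z => dens (v (fib z))) := by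
      rw [← avg_const_mul]
      refine avg_le_avg fun z => (hv _ (hD.left z)).2 (fun y => H (Sum.elim y z)) fun φ hφ => ?_
      simpa only [subspaceMap_leftCode] using hHφ _ (hφ.left z)
    have h2 : avg (fun y => avg fun z => ind (z ∈ D' y) * H (Sum.elim y z)) ≤
        (τ + (1 - c) ^ R) * avg (fun y => dens (D' y)) + (1 - (1 - c) ^ R) * σ := by
      rw [← avg_const_mul, ← avg_const (X := κ → Option α) ((1 - (1 - c) ^ R) * σ), ← avg_add]
      refine avg_le_avg fun y => ?_
      rw [add_mul]
      refine hι (D' y) (hD' y) (fun z => H (Sum.elim y z)) (fun z => hH _) fun φ hφ => ?_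
      simpa only [subspaceMap_rightCode] using hHφ _ (hφ.right y)
    have h3 : avg (fun w => ind (w ∈ D) * H w) =
        avg (fun z => avg fun y => ind (y ∈ v (fib z)) * H (Sum.elim y z)) +
        avg (fun y => avg fun z => ind (z ∈ D' y) * H (Sum.elim y z)) := by
      rw [avg_sum_elim, avg_comm (fun z y => ind (y ∈ v (fib z)) * H (Sum.elim y z)), ← avg_add]
      congr 1
      funext y
      rw [← avg_add]
      simp only [hsplit, add_mul]
    rw [h3]
    have hq : 0 ≤ (1 - c) ^ R := pow_nonneg (by linarith) R
    have h4 := mul_le_mul_of_nonneg_left hV hq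
    rw [pow_succ]
    nlinarith
theorem DHJ.avg_ind_insensitive_le [Nonempty α] (h : DHJ α) (a : α) (ζ : Type) [Finite ζ]
    {τ τ' : ℝ} (hτ' : 0 ≤ τ') (hτ : τ' < τ) :
    ∃ (ι : Type) (_ : Finite ι), ∀ D : Set (ι → Option α), Insensitive a D →
      ∀ H : (ι → Option α) → ℝ, (∀ w, H w ≤ 1) →
        (∀ φ : ι → Option α ⊕ ζ, Proper φ → avg (fun x => H (subspaceMap φ x)) ≤ τ') →
        avg (fun w => ind (w ∈ D) * H w) ≤ τ := by
  have hσ : 0 < min ((τ - τ') / 2) 1 := lt_min (by linarith) one_pos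
  obtain ⟨κ, _, hκ⟩ := h.exists_subspace_insensitive a ζ hσ
  have hc0 : (0 : ℝ) < Nat.card (ζ → Option α) / Nat.card (κ → Option α) := by
    have h1 : (0 : ℝ) < Nat.card (ζ → Option α) := by exact_mod_cast Nat.card_pos
    have h2 : (0 : ℝ) < Nat.card (κ → Option α) := by exact_mod_cast Nat.card_pos
    positivity
  have hc1 : (Nat.card (ζ → Option α) / Nat.card (κ → Option α) : ℝ) ≤ 1 := by
    obtain ⟨φ, hφ, -⟩ := hκ Set.univ (fun _ _ _ => Iff.rfl) (by
      simp [dens, ind_true, avg_const])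
    refine div_le_one_of_le₀ ?_ (Nat.cast_nonneg _)
    exact_mod_cast Nat.card_le_card_of_injective _ (subspaceMap_injective hφ)
  obtain ⟨R, hR⟩ := exists_pow_lt_of_lt_one (show 0 < (τ - τ') / 2 by linarith)
    (show 1 - (Nat.card (ζ → Option α) / Nat.card (κ → Option α) : ℝ) < 1 by linarith)
  obtain ⟨ι, _, hι⟩ := avg_ind_insensitive_le_aux hσ hτ' rfl hc1 hκ R
  refine ⟨ι, inferInstance, fun D hD H hH hHφ => (hι D hD H hH hHφ).trans ?_⟩
  have hq : 0 ≤ (1 - (Nat.card (ζ → Option α) / Nat.card (κ → Option α) : ℝ)) ^ R :=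
    pow_nonneg (by linarith) R
  have hd := dens_le_one D
  have hd0 := dens_nonneg D
  have hm := min_le_left ((τ - τ') / 2) 1
  nlinarith

theorem DHJ.avg_ind_forall_insensitive_le [Nonempty α] (h : DHJ α) (s : Finset α) :
    ∀ {τ : ℝ}, 0 < τ → ∀ (ζ : Type) [Finite ζ],
    ∃ (η : Type) (_ : Finite η), ∀ D : α → Set (η → Option α), (∀ a, Insensitive a (D a)) →
      ∀ F : (η → Option α) → ℝ, (∀ w, F w ≤ 1) →
        (∀ φ : η → Option α ⊕ ζ, Proper φ → avg (fun x => F (subspaceMap φ x)) ≤ 0) →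
        avg (fun w => ind (∀ a ∈ s, w ∈ D a) * F w) ≤ τ := by
  classical
  induction s using Finset.induction with
  | empty =>
    intro τ hτ ζ _
    refine ⟨ζ, inferInstance, fun D _ F _ hFφ => ?_⟩
    simp only [Finset.notMem_empty, false_imp_iff, implies_true, ind_true, one_mul]
    exact (hFφ _ proper_inr).trans hτ.le
  | insert a s _ ih =>
    intro τ hτ ζ _
    obtain ⟨ζ', _, hζ'⟩ := ih (half_pos hτ) ζ
    obtain ⟨η, _, hη⟩ := h.avg_ind_insensitive_le a ζ' (half_pos hτ).le (half_lt_self hτ)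
    refine ⟨η, inferInstance, fun D hD F hF hFφ => ?_⟩
    have hsplit : ∀ w, ind (∀ b ∈ insert a s, w ∈ D b) * F w =
        ind (w ∈ D a) * (ind (∀ b ∈ s, w ∈ D b) * F w) := by
      intro w
      rw [← mul_assoc]
      congr 1
      simp only [Finset.forall_mem_insert]
      by_cases h1 : w ∈ D a
      · simp [h1, ind_true]
      · simp [h1, ind_false]
    simp only [hsplit]
    refine hη _ (hD a) _ (fun w => ?_) fun φ hφ => ?_
    · nlinarith [hF w, ind_nonneg (∀ b ∈ s, w ∈ D b), ind_le_one (∀ b ∈ s, w ∈ D b)]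
    · refine hζ' (fun b => {w | subspaceMap φ w ∈ D b}) (fun b => (hD b).preimage φ)
        (fun x => F (subspaceMap φ x)) (fun x => hF _) fun ψ hψ => ?_
      simpa only [subspaceMap_comp] using hFφ _ (hφ.comp hψ)

end

section

variable {α : Type} [Finite α]

theorem Insensitive.iff {α ι : Type*} {a : α} {D : Set (ι → Option α)}
    (h : Insensitive a D) (p : Prop) : Insensitive a {w | w ∈ D ↔ p} :=
  fun _ _ hw => iff_congr (h _ _ hw) Iff.rfl

theorem DHJ.dens_le_of_forall_insensitive [Nonempty α] (h : DHJ α) {τ : ℝ} (hτ : 0 < τ)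
    (ζ : Type) [Finite ζ] : ∃ (η : Type) (_ : Finite η),
      ∀ C : α → Set (η → Option α), (∀ a, Insensitive a (C a)) →
      ∀ (B : Set (η → Option α)) {d : ℝ}, 0 ≤ d →
        (∀ φ : η → Option α ⊕ ζ, Proper φ → dens {x | subspaceMap φ x ∈ B} ≤ d) →
        (∀ w ∈ B, ∃ a, w ∉ C a) → dens B ≤ d * (1 - dens {w | ∀ a, w ∈ C a}) + τ := by
  classical
  let := Fintype.ofFinite α
  obtain ⟨η, _, hη⟩ := h.avg_ind_forall_insensitive_le Finset.univ
    (show 0 < τ / Fintype.card (Finset α) by positivity) ζ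
  refine ⟨η, inferInstance, fun C hC B d hd hB hBC => ?_⟩
  have hpart : ∀ w, ∑ s : Finset α, ind (∀ a ∈ Finset.univ, w ∈ {w | w ∈ C a ↔ a ∈ s}) = 1 := by
    intro w
    rw [Finset.sum_eq_single (Finset.univ.filter fun a => w ∈ C a)]
    · exact ind_true (by simp)
    · intro s _ hs
      refine ind_false fun hw => hs ?_
      ext a
      simpa using (hw a (Finset.mem_univ a)).symm
    · simp
  have hle : ∀ s ∈ Finset.univ.erase (Finset.univ : Finset α),
      avg (fun w => ind (∀ a ∈ Finset.univ, w ∈ {w | w ∈ C a ↔ a ∈ s}) * (ind (w ∈ B) - d)) ≤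
        τ / Fintype.card (Finset α) := by
    intro s _
    refine hη _ (fun a => (hC a).iff _) _ (fun w => ?_) fun φ hφ => ?_
    · linarith [ind_le_one (w ∈ B)]
    · rw [avg_sub, avg_const, sub_nonpos]
      exact hB φ hφ
  have hsum := Finset.sum_le_card_nsmul _ _ _ hle
  rw [← avg_sum] at hsum
  have hcard : ((Finset.univ.erase (Finset.univ : Finset α)).card : ℝ) *
      (τ / Fintype.card (Finset α)) ≤ τ := by
    have h1 : ((Finset.univ.erase (Finset.univ : Finset α)).card : ℝ) ≤
        Fintype.card (Finset α) := by
      exact_mod_cast Finset.card_le_univ _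
    have h2 : (0 : ℝ) < Fintype.card (Finset α) := by positivity
    rw [mul_div_assoc', div_le_iff₀ h2]
    nlinarith
  rw [nsmul_eq_mul] at hsum
  have hpt : ∀ w, ∑ s ∈ Finset.univ.erase (Finset.univ : Finset α),
      ind (∀ a ∈ Finset.univ, w ∈ {w | w ∈ C a ↔ a ∈ s}) * (ind (w ∈ B) - d) =
      ind (w ∈ B) - d * (1 - ind (w ∈ {w | ∀ a, w ∈ C a})) := by
    intro w
    have h0 := hpart w
    rw [← Finset.add_sum_erase _ _ (Finset.mem_univ (Finset.univ : Finset α))] at h0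
    simp only [Finset.mem_univ, iff_true, forall_const, Set.ofPred_mem_eq] at h0
    rw [← Finset.sum_mul]
    by_cases hw : ∀ a, w ∈ C a
    · have hwB : w ∉ B := fun hwB => by
        obtain ⟨a, ha⟩ := hBC w hwB
        exact ha (hw a)
      rw [ind_true hw] at h0
      rw [ind_true (show w ∈ {w | ∀ a, w ∈ C a} from hw), ind_false hwB]
      simp only [Finset.mem_univ, true_imp_iff]
      rw [show (∑ s ∈ Finset.univ.erase (Finset.univ : Finset α),
        ind (∀ a, w ∈ {w | w ∈ C a ↔ a ∈ s})) = 0 by linarith]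
      ring
    · rw [ind_false hw] at h0
      rw [ind_false (show w ∉ {w | ∀ a, w ∈ C a} from hw)]
      simp only [Finset.mem_univ, true_imp_iff]
      rw [show (∑ s ∈ Finset.univ.erase (Finset.univ : Finset α),
        ind (∀ a, w ∈ {w | w ∈ C a ↔ a ∈ s})) = 1 by linarith]
      ring
  simp only [hpt] at hsum
  rw [avg_sub, avg_const_mul, avg_sub, avg_const] at hsum
  unfold dens
  linarith

theorem DHJ.exists_lt_dhjAt [Nonempty α] (h : DHJ α) {δ : ℝ} (hδ : 0 < δ)
    (hup : ∀ δ' > δ, DHJAt (Option α) δ') : ∃ δ' < δ, 0 < δ' ∧ DHJAt (Option α) δ' := by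
  classical
  obtain ⟨ι₀, _, θ₁, hθ₁, hline₁⟩ := h.exists_line_avg (half_pos hδ)
  set θ : ℝ := min θ₁ 1
  have hθ : 0 < θ := lt_min hθ₁ one_pos
  have hθ1 : θ ≤ 1 := min_le_right _ _
  have hθle : θ ≤ θ₁ := min_le_left _ _
  obtain ⟨ζ, _, hζ⟩ := hup (δ + δ * θ / 4) (by nlinarith [mul_pos hδ hθ])
  obtain ⟨η, _, hη⟩ := h.dens_le_of_forall_insensitive
    (show 0 < δ * θ / 4 by positivity) ζ
  obtain ⟨ι₁, _, hι₁⟩ := exists_subspace_of_properties α η (Nat.card ι₀) Unit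
  have hK : (1 : ℝ) ≤ Nat.card (ι₁ → Option α) := by exact_mod_cast Nat.card_pos
  set K : ℝ := ((Nat.card (ι₁ → Option α) : ℕ) : ℝ) with hKdef
  set ε : ℝ := δ * θ / (8 * K) with hε
  have hKε : 2 * K * ε = δ * θ / 4 := by
    rw [hε]; field_simp; norm_num
  have hε0 : 0 < ε := by positivity
  have hδθ : δ * θ ≤ δ := by nlinarith
  have hεδ : ε < δ := by nlinarith
  obtain ⟨ι₂, _, hι₂⟩ := hup (δ + ε) (by linarith)
  refine ⟨δ - ε, by linarith, by linarith, ι₁ ⊕ ι₂, inferInstance, fun A hA => ?_⟩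
  by_contra hno
  have hfib : ∀ y : ι₁ → Option α, δ - δ * θ / 4 ≤ dens {z : ι₂ → Option α | Sum.elim y z ∈ A} := by
    intro y
    unfold dens at hA
    rw [avg_sum_elim] at hA
    have := le_of_avg (f := fun y : ι₁ → Option α => dens {z : ι₂ → Option α | Sum.elim y z ∈ A})
      (c := δ) (e := ε) (fun y => ?_) hA y
    · rw [← hKdef, hKε] at this
      linarith
    · by_contra hlt
      refine hno (HasLine.of_subspace ((proper_inr (η := ι₂)).right y) ?_)
      simpa only [subspaceMap_rightCode, subspaceMap_inr] using hι₂ _ (not_le.mp hlt).le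
  rcases hι₁ fun _ w => θ ≤ dens {z : ι₂ → Option α |
      ∀ a, Sum.elim (fun i => some (subst a w i)) z ∈ A} with ⟨-, φ, hφ, hG⟩ | ⟨ψ, hψ, hG⟩
  swap
  · have e : Fin (Nat.card ι₀) ≃ ι₀ := (Finite.equivFin ι₀).symm
    obtain ⟨w, ⟨i, hi⟩, hw⟩ := hline₁ (ι₂ → Option α)
      (fun x => {z | Sum.elim (fun i => some (subspaceMap ψ (fun j => x (e j)) i)) z ∈ A}) (by
        rw [← avg_const (X := ι₀ → α) (δ / 2)]
        exact avg_le_avg fun x => le_trans (by linarith) (hfib _))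
    refine hG () (fun j => w (e j)) ⟨e.symm i, by simpa using hi⟩ (hθle.trans ?_)
    simp only [subst_liftCode]
    exact hw
  let V : (Option η → Option α) → ι₁ → Option α := subspaceMap (liftCode φ)
  let B : (ι₂ → Option α) → Set (η → Option α) := fun z =>
    {w | Sum.elim (V (consWord none w)) z ∈ A}
  let C : (ι₂ → Option α) → α → Set (η → Option α) := fun z a =>
    {w | Sum.elim (V (consWord (some a) fun i => some (subst a w i))) z ∈ A}
  have hBavg : δ - δ * θ / 4 ≤ avg fun z => dens (B z) := by
    unfold dens
    rw [avg_comm, ← avg_const (X := η → Option α) (δ - δ * θ / 4)]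
    exact avg_le_avg fun w => hfib _
  have hCavg : θ ≤ avg fun z => dens {w | ∀ a, w ∈ C z a} := by
    unfold dens
    rw [avg_comm, ← avg_const (X := η → Option α) θ]
    refine avg_le_avg fun w => (hG w).trans (dens_le fun z hz a => ?_)
    have := hz a
    rw [subst_liftCode] at this
    have hV : V (consWord (some a) fun i => some (subst a w i)) =
        fun i => some (subspaceMap φ (subst a (consWord none w)) i) := by
      rw [← subspaceMap_liftCode_some]
      congr 1
      funext o
      rcases o with _ | i <;> simp [consWord, subst]
    change Sum.elim (V _) z ∈ A
    rw [hV]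
    exact this
  obtain ⟨z, hz⟩ := exists_avg_le fun z => dens (B z) + δ * dens {w | ∀ a, w ∈ C z a}
  rw [avg_add, avg_const_mul] at hz
  have hVz : Proper (leftCode (liftCode φ) z) := hφ.lift.left z
  have hfinal := hη (C z) (fun a w w' hw => by simp [C, hw]) (B z)
    (d := δ + δ * θ / 4) (by positivity) ?_ ?_
  · have hd := dens_nonneg {w | ∀ a, w ∈ C z a}
    have := mul_le_mul_of_nonneg_left hCavg hδ.le
    have h3 : 0 ≤ δ * θ / 4 * dens {w | ∀ a, w ∈ C z a} := by positivity
    have h4 : 0 < δ * θ := by positivity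
    nlinarith
  · intro ρ hρ
    by_contra hlt
    have h1 : HasLine (B z) := HasLine.of_subspace hρ (hζ _ (not_le.mp hlt).le)
    have hc : Proper (constCode (none : Option α) (Sum.inr : η → Option α ⊕ η)) :=
      Proper.const proper_inr none
    refine hno (HasLine.of_subspace (hVz.comp hc) (h1.mono fun w hw => ?_))
    have h2 : subspaceMap (constCode (none : Option α) Sum.inr) w = consWord none w := by
      funext o
      rcases o with _ | i <;> simp [subspaceMap, constCode, consWord]
    change subspaceMap _ w ∈ A
    rw [subspaceMap_comp, subspaceMap_leftCode, h2]
    exact hw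
  · intro w hw
    by_contra! hC
    refine hno (HasLine.of_subspace hVz ⟨consWord none fun i => (w i).map some, ⟨none, rfl⟩, ?_⟩)
    intro b
    change subspaceMap _ _ ∈ A
    rw [subspaceMap_leftCode]
    rcases b with _ | a
    · have key : subst none (consWord none fun i => (w i).map some) = consWord none w := by
        funext o
        rcases o with _ | i
        · rfl
        · rcases hi : w i with _ | c <;> simp [subst, consWord, hi]
      rw [key]
      exact hw
    · have key : subst (some a) (consWord none fun i => (w i).map some) =
          consWord (some a) fun i => some (subst a w i) := by
        funext o
        rcases o with _ | i
        · rfl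
        · rcases hi : w i with _ | c <;> simp [subst, consWord, hi]
      rw [key]
      exact hC a

theorem DHJAt.mono {α : Type} [Finite α] {δ δ' : ℝ} (h : DHJAt α δ) (hle : δ ≤ δ') :
    DHJAt α δ' := by
  obtain ⟨ι, _, hι⟩ := h
  exact ⟨ι, inferInstance, fun A hA => hι A (hle.trans hA)⟩

theorem dhjAt_two (α : Type) [Finite α] [Nonempty α] : DHJAt α 2 :=
  ⟨Unit, inferInstance, fun A hA => by linarith [dens_le_one A]⟩

theorem DHJ.option [Nonempty α] (h : DHJ α) : DHJ (Option α) := by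
  intro δ hδ
  by_contra hno
  let S : Set ℝ := {δ | 0 < δ ∧ DHJAt (Option α) δ}
  have hS : S.Nonempty := ⟨2, two_pos, dhjAt_two _⟩
  have hlow : ∀ x ∈ S, δ ≤ x := fun x hx => by
    by_contra hlt
    exact hno (hx.2.mono (not_le.mp hlt).le)
  have hbdd : BddBelow S := ⟨δ, hlow⟩
  have h0 : 0 < sInf S := hδ.trans_le (le_csInf hS hlow)
  obtain ⟨δ', hlt, hpos, hδ'⟩ := h.exists_lt_dhjAt h0 fun x hx => by
    obtain ⟨y, hy, hyx⟩ := exists_lt_of_csInf_lt hS hx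
    exact hy.2.mono hyx.le
  exact absurd (csInf_le hbdd ⟨hpos, hδ'⟩) (not_le.mpr hlt)

theorem DHJ.of_equiv {α β : Type} [Finite α] [Finite β] (e : α ≃ β) (h : DHJ α) : DHJ β := by
  intro δ hδ
  obtain ⟨ι, _, hι⟩ := h δ hδ
  refine ⟨ι, inferInstance, fun A hA => ?_⟩
  have hd : dens A = dens {x : ι → α | (fun i => e (x i)) ∈ A} :=
    (avg_equiv (Equiv.arrowCongr (Equiv.refl ι) e) fun y => ind (y ∈ A)).symm
  obtain ⟨w, ⟨i, hi⟩, hw⟩ := hι _ (hA.trans_eq hd)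
  refine ⟨fun i => (w i).map e, ⟨i, by simp [hi]⟩, fun b => ?_⟩
  have := hw (e.symm b)
  change (fun i => e (subst (e.symm b) w i)) ∈ A at this
  convert this using 1
  funext i
  rcases hi : w i with _ | c <;> simp [subst, hi]

theorem dhj_unique (α : Type) [Finite α] [Unique α] : DHJ α := by
  intro δ hδ
  refine ⟨Unit, inferInstance, fun A hA => ?_⟩
  obtain ⟨x, hx⟩ := nonempty_of_dens_pos (hδ.trans_le hA)
  exact ⟨fun _ => none, ⟨(), rfl⟩, fun a => by rwa [Subsingleton.elim (subst a _) x]⟩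

/-- The density Hales–Jewett theorem. -/
theorem dhj_option (α : Type) [hα : Finite α] : DHJ (Option α) := by
  refine Finite.induction_empty_option (P := fun α => ∀ [Finite α], DHJ (Option α))
    (fun e ih _ => ?_) (dhj_unique (Option PEmpty)) (fun ih _ => ih.option) α
  have := Finite.of_equiv _ e.symm
  exact ih.of_equiv (Equiv.optionCongr e)

end

theorem prod_subst {α ι M : Type*} [Fintype ι] [CommMonoid M] (S : α → M) (w : ι → Option α)
    (a : α) : ∏ i, S (subst a w i) =
      S a ^ Nat.card {i // w i = none} * ∏ i, (w i).elim 1 S := by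
  classical
  have : S a ^ Nat.card {i // w i = none} = ∏ i, (if w i = none then S a else 1) := by
    rw [Finset.prod_ite, Nat.card_eq_fintype_card, Fintype.card_subtype]
    simp
  rw [this, ← Finset.prod_mul_distrib]
  refine Finset.prod_congr rfl fun i _ => ?_
  rcases h : w i with _ | b <;> simp [subst, h]

/-- The multiple recurrence theorem for commuting measure preserving transformations. -/
theorem exists_pos_measure_recurrence {X : Type*} [MeasurableSpace X] (μ : Measure X)
    [IsProbabilityMeasure μ] {M : Type*} [CommMonoid M] (ρ : M →* Function.End X)
    (hρ : ∀ m, MeasurePreserving (ρ m) μ μ) {α : Type} [Finite α] (g : α → M) {A : Set X}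
    (hA : MeasurableSet A) (hpos : 0 < μ A) :
    ∃ n : ℕ, 1 ≤ n ∧ 0 < μ {x | x ∈ A ∧ ∀ a, ρ (g a ^ n) x ∈ A} := by
  classical
  have hδ : 0 < μ.real A := ENNReal.toReal_pos hpos.ne' (measure_ne_top μ A)
  obtain ⟨ι, _, hι⟩ := dhj_option α (μ.real A / 2) (half_pos hδ)
  let := Fintype.ofFinite ι
  let := Fintype.ofFinite α
  let S : Option α → M := fun o => o.elim 1 g
  let m : (ι → Option α) → M := fun x => ∏ i, S (x i)
  let F : X → Set (ι → Option α) := fun ω => {x | ρ (m x) ω ∈ A}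
  have hmeas : ∀ r : M, MeasurableSet {ω | ρ r ω ∈ A} := fun r => (hρ r).measurable hA
  have hex : ∃ w : ι → Option (Option α), (∃ i, w i = none) ∧
      0 < μ {ω | ∀ a, ρ (m (subst a w)) ω ∈ A} := by
    by_contra! hno
    have hae : ∀ᵐ ω ∂μ, dens (F ω) ≤ μ.real A / 2 := by
      have : ∀ᵐ ω ∂μ, ∀ w : ι → Option (Option α), (∃ i, w i = none) →
          ¬ ∀ a, ρ (m (subst a w)) ω ∈ A := by
        rw [ae_all_iff]
        intro w
        by_cases hw : ∃ i, w i = none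
        · have h0 := nonpos_iff_eq_zero.mp (hno w hw)
          filter_upwards [measure_eq_zero_iff_ae_notMem.mp h0] with ω hω _
          exact hω
        · exact Filter.Eventually.of_forall fun ω h => absurd h hw
      filter_upwards [this] with ω hω
      by_contra hlt
      obtain ⟨w, hw, hwF⟩ := hι (F ω) (not_le.mp hlt).le
      exact hω w hw hwF
    have hind : ∀ x, (fun ω => ind (x ∈ F ω)) = Set.indicator {ω | ρ (m x) ω ∈ A} 1 := by
      intro x
      funext ω
      by_cases h : ρ (m x) ω ∈ A
      · rw [ind_true (show x ∈ F ω from h), Set.indicator_of_mem (by exact h)]; rfl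
      · rw [ind_false (show x ∉ F ω from h), Set.indicator_of_notMem (by exact h)]
    have h_integrable : ∀ x, Integrable (fun ω => ind (x ∈ F ω)) μ := by
      intro x
      rw [hind]
      exact (integrable_const (1 : ℝ)).indicator (hmeas _)
    have hval : ∀ x, ∫ ω, ind (x ∈ F ω) ∂μ = μ.real A := by
      intro x
      rw [hind, integral_indicator_one (hmeas _)]
      exact (hρ (m x)).measureReal_preimage hA.nullMeasurableSet
    have hdens : ∀ ω, dens (F ω) =
        (∑ x, ind (x ∈ F ω)) / Fintype.card (ι → Option α) := fun ω => avg_eq _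
    have hI : ∫ ω, dens (F ω) ∂μ = μ.real A := by
      simp only [hdens]
      rw [integral_div, integral_finsetSum _ fun x _ => h_integrable x]
      simp only [hval]
      rw [Finset.sum_const, nsmul_eq_mul, Finset.card_univ, mul_div_cancel_left₀]
      exact_mod_cast Fintype.card_ne_zero
    have hInt : Integrable (fun ω => dens (F ω)) μ := by
      simp only [hdens]
      exact (integrable_finsetSum _ fun x _ => h_integrable x).div_const _
    have hle := integral_mono_ae hInt (integrable_const (μ.real A / 2)) hae
    rw [hI, integral_const, probReal_univ, one_smul] at hle
    linarith
  obtain ⟨w, ⟨i, hi⟩, hw⟩ := hex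
  have hn : 1 ≤ Nat.card {i // w i = none} := by
    have : Nonempty {i // w i = none} := ⟨⟨i, hi⟩⟩
    exact Nat.card_pos
  refine ⟨_, hn, hw.trans_eq ?_⟩
  have hset : {ω | ∀ a, ρ (m (subst a w)) ω ∈ A} =
      ρ (∏ i, (w i).elim 1 S) ⁻¹' {x | x ∈ A ∧ ∀ a, ρ (g a ^ Nat.card {i // w i = none}) x ∈ A} := by
    ext ω
    simp only [m, prod_subst, map_mul]
    constructor
    · intro h
      refine ⟨?_, fun a => h (some a)⟩
      simpa [S] using h none
    · rintro ⟨h1, h2⟩ (_ | a)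
      · simpa [S] using h1
      · exact h2 a
  rw [hset]
  refine (hρ _).measure_preimage (MeasurableSet.nullMeasurableSet ?_)
  have : {x | x ∈ A ∧ ∀ a, ρ (g a ^ Nat.card {i // w i = none}) x ∈ A} =
      A ∩ ⋂ a, {x | ρ (g a ^ Nat.card {i // w i = none}) x ∈ A} := by
    ext x; simp
  rw [this]
  exact hA.inter (MeasurableSet.iInter fun a => hmeas _)

open scoped IsMulCommutative in
theorem exists_pos_measure_iterate {X : Type*} [MeasurableSpace X] (μ : Measure X)
    [IsProbabilityMeasure μ] {k : ℕ} (T : Fin k → X → X)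
    (hT : ∀ i, MeasurePreserving (T i) μ μ) (hcomm : ∀ i j, T i ∘ T j = T j ∘ T i)
    {A : Set X} (hA : MeasurableSet A) (hpos : 0 < μ A) :
    ∃ n : ℕ, 1 ≤ n ∧ 0 < μ {x | x ∈ A ∧ ∀ i, (T i)^[n] x ∈ A} := by
  let T' : Fin k → Function.End X := T
  have hc : ∀ a ∈ Set.range T', ∀ b ∈ Set.range T', a * b = b * a := by
    rintro _ ⟨i, rfl⟩ _ ⟨j, rfl⟩
    exact hcomm i j
  have := Submonoid.isMulCommutative_closure _ hc
  have hρ : ∀ m : Submonoid.closure (Set.range T'),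
      MeasurePreserving ((Submonoid.closure (Set.range T')).subtype m) μ μ := by
    rintro ⟨m, hm⟩
    change MeasurePreserving m μ μ
    induction hm using Submonoid.closure_induction with
    | mem x hx =>
      obtain ⟨i, rfl⟩ := hx
      exact hT i
    | one => exact MeasurePreserving.id μ
    | mul x y _ _ hx hy => exact hx.comp hy
  obtain ⟨n, hn, hn'⟩ := exists_pos_measure_recurrence μ
    (Submonoid.closure (Set.range T')).subtype hρ
    (fun i => ⟨T' i, Submonoid.subset_closure ⟨i, rfl⟩⟩) hA hpos
  refine ⟨n, hn, ?_⟩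
  convert hn' using 5 with x
  refine forall_congr' fun i => ?_
  rw [map_pow]
  change _ ↔ (T' i ^ n) x ∈ A
  rw [show (T' i ^ n) = (T i)^[n] from ?_]
  clear hn hn'
  induction n with
  | zero => rfl
  | succ n ih => rw [pow_succ, ih]; rfl

end DensityHJ

theorem isPrefixOf_iff_eq_prefixList {σ : List Bool} {Z : ℕ → Bool} :
    IsPrefixOf σ Z ↔ σ = prefixList Z σ.length := by
  constructor
  · intro h
    refine List.ext_getElem (by simp [prefixList]) fun i h1 h2 => ?_
    have := h i h1
    rw [List.getD_eq_getElem _ _ h1] at this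
    simpa [prefixList] using this
  · intro h i hi
    rw [List.getD_eq_getElem _ _ hi]
    have h2 : i < (prefixList Z σ.length).length := by simpa [prefixList] using hi
    calc σ[i] = (prefixList Z σ.length)[i] := by congr 1
      _ = Z i := by simp [prefixList]

theorem isPrefixOf_prefixList (Z : ℕ → Bool) (n : ℕ) : IsPrefixOf (prefixList Z n) Z := by
  rw [isPrefixOf_iff_eq_prefixList]
  simp [prefixList]

theorem length_prefixList (Z : ℕ → Bool) (n : ℕ) : (prefixList Z n).length = n := by
  simp [prefixList]

theorem IsPrefixOf.of_prefix {σ τ : List Bool} {Z : ℕ → Bool} (h : IsPrefixOf τ Z)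
    (hστ : σ <+: τ) : IsPrefixOf σ Z := by
  intro i hi
  have hi' : i < τ.length := hi.trans_le hστ.length_le
  rw [← h i hi', List.getD_eq_getElem _ _ hi, List.getD_eq_getElem _ _ hi']
  exact hστ.getElem hi

theorem IsPrefixOf.prefix_of_length_le {σ τ : List Bool} {Z : ℕ → Bool} (h : IsPrefixOf σ Z)
    (h' : IsPrefixOf τ Z) (hle : σ.length ≤ τ.length) : σ <+: τ := by
  rw [List.prefix_iff_eq_take]
  refine List.ext_getElem (by simpa using hle) fun i h1 h2 => ?_
  have e1 := h i h1
  have e2 := h' i (h1.trans_le hle)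
  rw [List.getD_eq_getElem _ _ h1] at e1
  rw [List.getD_eq_getElem _ _ (h1.trans_le hle)] at e2
  simp [e1, e2]

theorem prefixList_prefix (Z : ℕ → Bool) {m n : ℕ} (h : m ≤ n) :
    prefixList Z m <+: prefixList Z n :=
  (isPrefixOf_prefixList Z m).prefix_of_length_le (isPrefixOf_prefixList Z n)
    (by simpa [length_prefixList] using h)

theorem measurableSet_isPrefixOf (σ : List Bool) : MeasurableSet {Z | IsPrefixOf σ Z} := by
  have : {Z | IsPrefixOf σ Z} = ⋂ i : ℕ, ⋂ _ : i < σ.length, {Z | Z i = σ.getD i false} := by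
    ext Z
    simp [IsPrefixOf, eq_comm]
  rw [this]
  exact MeasurableSet.iInter fun i => MeasurableSet.iInter fun _ =>
    measurable_pi_apply i (measurableSet_singleton _)

theorem measurableSet_openCl (S : Set (List Bool)) : MeasurableSet (openCl S) := by
  have : openCl S = ⋃ σ ∈ S, {Z | IsPrefixOf σ Z} := by
    ext Z
    simp [openCl]
  rw [this]
  exact MeasurableSet.biUnion (Set.to_countable S) fun σ _ => measurableSet_isPrefixOf σ

theorem IsUniformMeasure.isProbabilityMeasure {μ : Measure (ℕ → Bool)} (h : IsUniformMeasure μ) :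
    IsProbabilityMeasure μ := by
  refine ⟨?_⟩
  have h0 := h []
  simpa [IsPrefixOf] using h0

section

variable {f : List Bool → List Bool} {T : (ℕ → Bool) → ℕ → Bool}
  (hf : ∀ σ τ : List Bool, σ <+: τ → f σ <+: f τ)
  (hT : ∀ Z m, ∃ n, m ≤ (f (prefixList Z n)).length ∧ IsPrefixOf (f (prefixList Z n)) (T Z))

include hf hT

theorem isPrefixOf_apply {σ : List Bool} {Z : ℕ → Bool} (h : IsPrefixOf σ Z) :
    IsPrefixOf (f σ) (T Z) := by
  obtain ⟨N, hN, hp⟩ := hT Z (f σ).length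
  refine hp.of_prefix (List.prefix_of_prefix_length_le (l₃ := f (prefixList Z (max N σ.length)))
    (hf _ _ ?_) (hf _ _ (prefixList_prefix Z (le_max_left _ _))) hN)
  rw [isPrefixOf_iff_eq_prefixList.mp h, length_prefixList]
  exact prefixList_prefix Z (le_max_right _ _)

theorem isPrefixOf_iterate {σ : List Bool} {Z : ℕ → Bool} (h : IsPrefixOf σ Z) (n : ℕ) :
    IsPrefixOf (f^[n] σ) (T^[n] Z) := by
  induction n with
  | zero => exact h
  | succ n ih =>
    rw [Function.iterate_succ_apply', Function.iterate_succ_apply']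
    exact isPrefixOf_apply hf hT ih

theorem exists_le_length_iterate (Z : ℕ → Bool) (n m : ℕ) :
    ∃ N₀, ∀ N ≥ N₀, m ≤ (f^[n] (prefixList Z N)).length := by
  induction n generalizing m with
  | zero => exact ⟨m, fun N hN => by simpa [length_prefixList] using hN⟩
  | succ n ih =>
    obtain ⟨L, hL, -⟩ := hT (T^[n] Z) m
    obtain ⟨N₀, hN₀⟩ := ih L
    refine ⟨N₀, fun N hN => ?_⟩
    rw [Function.iterate_succ_apply']
    have h1 := isPrefixOf_iterate hf hT (isPrefixOf_prefixList Z N) n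
    rw [isPrefixOf_iff_eq_prefixList] at h1
    rw [h1]
    exact hL.trans (hf _ _ (prefixList_prefix _ (hN₀ N hN))).length_le

end

/-- Boolean prefix test. -/
def prefixTest (w σ : List Bool) : Bool := decide (σ.take w.length = w)

theorem prefixTest_eq_true {w σ : List Bool} : prefixTest w σ = true ↔ w <+: σ := by
  rw [prefixTest, decide_eq_true_iff, List.prefix_iff_eq_take, eq_comm]

theorem primrec₂_prefixTest : Primrec₂ prefixTest :=
  (Primrec.eq.decide.comp₂
    (Primrec.list_take.comp₂ (Primrec.list_length.comp Primrec.fst).to₂ Primrec₂.right)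
    Primrec₂.left)

/-- `σ` is at least as long as the string enumerated by `W` at stage `n`, without extending it. -/
def avoidsAt (W : ℕ → Option (List Bool)) (σ : List Bool) (n : ℕ) : Bool :=
  Option.casesOn (W n) true fun w => decide (w.length ≤ σ.length) && !prefixTest w σ

/-- `avoidsAt` for all stages below `n`. -/
def avoidsBelow (W : ℕ → Option (List Bool)) (σ : List Bool) (n : ℕ) : Bool :=
  Nat.rec true (fun j b => b && avoidsAt W σ j) n

/-- The `n`-th iterate of `f` at `σ` extends the string enumerated by `W` at stage `s`. -/
def hitsAt (W : ℕ → Option (List Bool)) (f : List Bool → List Bool) (n : ℕ) (σ : List Bool)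
    (s : ℕ) : Bool :=
  Option.casesOn (W s) false fun w => prefixTest w (f^[n] σ)

theorem avoidsAt_eq_true {W : ℕ → Option (List Bool)} {σ : List Bool} {n : ℕ} :
    avoidsAt W σ n = true ↔ ∀ w, W n = some w → w.length ≤ σ.length ∧ ¬ w <+: σ := by
  unfold avoidsAt
  rcases W n with _ | w
  · simp
  · simp [← prefixTest_eq_true]

theorem avoidsBelow_eq_true {W : ℕ → Option (List Bool)} {σ : List Bool} {n : ℕ} :
    avoidsBelow W σ n = true ↔
      ∀ j < n, ∀ w, W j = some w → w.length ≤ σ.length ∧ ¬ w <+: σ := by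
  induction n with
  | zero => simp [avoidsBelow]
  | succ n ih =>
    have : avoidsBelow W σ (n + 1) = (avoidsBelow W σ n && avoidsAt W σ n) := rfl
    rw [this, Bool.and_eq_true, ih, avoidsAt_eq_true, Nat.forall_lt_succ_right]

theorem hitsAt_eq_true {W : ℕ → Option (List Bool)} {f : List Bool → List Bool} {n : ℕ}
    {σ : List Bool} {s : ℕ} :
    hitsAt W f n σ s = true ↔ ∃ w, W s = some w ∧ w <+: f^[n] σ := by
  unfold hitsAt
  rcases h : W s with _ | w
  · simp
  · simp [prefixTest_eq_true]

theorem computable₂_iterate {f : List Bool → List Bool} (hf : Computable f) :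
    Computable₂ fun (n : ℕ) (σ : List Bool) => f^[n] σ := by
  have hstep : Computable₂ fun (_ : ℕ × List Bool) (q : ℕ × List Bool) => f q.2 :=
    hf.comp (Computable.snd.comp Computable.snd)
  refine (Computable.nat_rec (f := fun p : ℕ × List Bool => p.1)
    (g := fun p : ℕ × List Bool => p.2) Computable.fst Computable.snd hstep).of_eq ?_
  rintro ⟨n, σ⟩
  induction n with
  | zero => rfl
  | succ n ih =>
    dsimp only at ih ⊢
    rw [Function.iterate_succ_apply', ← ih]

section

variable {W : ℕ → Option (List Bool)} (hW : Computable W)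

include hW

theorem computable₂_avoidsAt : Computable₂ (avoidsAt W) := by
  have hg : Primrec₂ fun (p : List Bool × ℕ) (w : List Bool) =>
      decide (w.length ≤ p.1.length) && !prefixTest w p.1 :=
    Primrec.and.comp
      (Primrec.nat_le.decide.comp (Primrec.list_length.comp Primrec.snd)
        (Primrec.list_length.comp (Primrec.fst.comp Primrec.fst)))
      (Primrec.not.comp (primrec₂_prefixTest.comp Primrec.snd (Primrec.fst.comp Primrec.fst)))
  exact Computable.option_casesOn (hW.comp Computable.snd) (Computable.const true) hg.to_comp

theorem computable₂_avoidsBelow : Computable₂ (avoidsBelow W) := by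
  have hstep : Computable₂ fun (p : List Bool × ℕ) (q : ℕ × Bool) => q.2 && avoidsAt W p.1 q.1 :=
    Primrec.and.to_comp.comp (Computable.snd.comp Computable.snd)
      ((computable₂_avoidsAt hW).comp (Computable.fst.comp Computable.fst)
        (Computable.fst.comp Computable.snd))
  exact Computable.nat_rec (f := fun p : List Bool × ℕ => p.2) (g := fun _ => true)
    Computable.snd (Computable.const true) hstep

theorem computable_hitsAt {f : List Bool → List Bool} (hf : Computable f) :
    Computable fun p : ℕ × List Bool × ℕ => hitsAt W f p.1 p.2.1 p.2.2 := by
  have hiter : Computable fun p : (ℕ × List Bool × ℕ) × List Bool => f^[p.1.1] p.1.2.1 :=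
    (computable₂_iterate hf).comp (Computable.fst.comp Computable.fst)
      (Computable.fst.comp (Computable.snd.comp Computable.fst))
  have hg : Computable₂ fun (p : ℕ × List Bool × ℕ) (w : List Bool) =>
      prefixTest w (f^[p.1] p.2.1) :=
    Computable₂.comp primrec₂_prefixTest.to_comp Computable.snd hiter
  exact Computable.option_casesOn (hW.comp (Computable.snd.comp Computable.snd))
    (Computable.const false) hg

theorem computable_any_hitsAt {k : ℕ} {f : Fin k → List Bool → List Bool}
    (hf : ∀ i, Computable (f i)) (l : List (Fin k)) :
    Computable fun p : ℕ × List Bool × ℕ => l.any fun i => hitsAt W (f i) p.1 p.2.1 p.2.2 := by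
  induction l with
  | nil => exact Computable.const false
  | cons i l ih =>
    simp only [List.any_cons]
    exact Primrec.or.to_comp.comp (computable_hitsAt hW (hf i)) ih

/-- The strings that avoid the first strings of `W` and are mapped into `W` by some iterate of
order `m + 1` are uniformly computably enumerable. -/
theorem uniformlyCE_return {k : ℕ} {f : Fin k → List Bool → List Bool}
    (hf : ∀ i, Computable (f i)) :
    UniformlyCE fun m => {σ | (∀ j < m + 1, ∀ w, W j = some w → w.length ≤ σ.length ∧ ¬ w <+: σ) ∧
      ∃ i s w, W s = some w ∧ w <+: (f i)^[m + 1] σ} := by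
  let check : ℕ → List Bool × ℕ → Bool := fun m p =>
    avoidsBelow W p.1 (m + 1) && (List.finRange k).any fun i => hitsAt W (f i) (m + 1) p.1 p.2
  have hcheck : Computable₂ check := by
    have hsucc : Computable fun q : ℕ × List Bool × ℕ => q.1 + 1 :=
      Computable.succ.comp Computable.fst
    have h1 : Computable fun q : ℕ × List Bool × ℕ => avoidsBelow W q.2.1 (q.1 + 1) :=
      Computable₂.comp (computable₂_avoidsBelow hW) (g := fun q : ℕ × List Bool × ℕ => q.2.1)
        (h := fun q : ℕ × List Bool × ℕ => q.1 + 1)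
        (Computable.fst.comp Computable.snd) hsucc
    have h2 : Computable fun q : ℕ × List Bool × ℕ =>
        (List.finRange k).any fun i => hitsAt W (f i) (q.1 + 1) q.2.1 q.2.2 :=
      Computable.comp (g := fun q : ℕ × List Bool × ℕ => (q.1 + 1, q.2))
        (computable_any_hitsAt hW hf (List.finRange k)) (hsucc.pair Computable.snd)
    have h3 := Computable₂.comp Primrec.and.to_comp h1 h2
    exact h3
  refine ⟨fun m t => (Encodable.decode (α := List Bool × ℕ) t).bind fun p =>
    bif check m p then some p.1 else none, ?_, fun m => ?_⟩
  · exact Computable.option_bind (Computable.decode.comp Computable.snd)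
      (Computable.cond (hcheck.comp (Computable.fst.comp Computable.fst) Computable.snd)
        (Computable.option_some.comp (Computable.fst.comp Computable.snd)) (Computable.const none))
  · ext σ
    have key : ∀ s, check m (σ, s) = true ↔
        (∀ j < m + 1, ∀ w, W j = some w → w.length ≤ σ.length ∧ ¬ w <+: σ) ∧
          ∃ i w, W s = some w ∧ w <+: (f i)^[m + 1] σ := by
      intro s
      simp only [check, Bool.and_eq_true, avoidsBelow_eq_true, List.any_eq_true, hitsAt_eq_true,
        List.mem_finRange, true_and]
    constructor
    · rintro ⟨h1, i, s, w, hw⟩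
      refine ⟨Encodable.encode (σ, s), ?_⟩
      dsimp only
      rw [Encodable.encodek, Option.bind_some, (key s).mpr ⟨h1, i, w, hw⟩]
      rfl
    · rintro ⟨t, ht⟩
      obtain ⟨⟨σ', s⟩, -, hp⟩ := Option.bind_eq_some_iff.mp ht
      rcases hc : check m (σ', s) with _ | _
      · simp [hc] at hp
      · obtain rfl : σ' = σ := by simpa [hc] using hp
        obtain ⟨h1, i, w, hw⟩ := (key s).mp hc
        exact ⟨h1, i, s, w, hw⟩

end

/-- For pairwise commuting computable measure-preserving transformations of Cantor space
and a Π⁰₁ class `P` of positive uniform measure, every weakly 2-random `z ∈ P` satisfies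
`z ∈ ⋂ i, (T i)^{-n} P` for some `n ≥ 1`. -/
theorem weak2Random_multiple_recurrence (μ : Measure (ℕ → Bool)) (hμ : IsUniformMeasure μ)
    (k : ℕ) (hk : 1 ≤ k) (T : Fin k → (ℕ → Bool) → (ℕ → Bool))
    (hTcomp : ∀ i, ComputableMap (T i))
    (hTmeas : ∀ i, Measurable (T i))
    (hTpres : ∀ i, ∀ A : Set (ℕ → Bool), MeasurableSet A → μ (T i ⁻¹' A) = μ A)
    (hTcomm : ∀ i j, T i ∘ T j = T j ∘ T i)
    (P : Set (ℕ → Bool)) (hP : Pi01Class P) (hPpos : 0 < μ P)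
    (z : ℕ → Bool) (hzP : z ∈ P) (hz : Weak2Random μ z) :
    ∃ n : ℕ, 1 ≤ n ∧ z ∈ ⋂ i : Fin k, (T i)^[n] ⁻¹' P := by
  have := hμ.isProbabilityMeasure
  obtain ⟨S, ⟨W, hW, hSW⟩, rfl⟩ := hP
  choose f hfc hfm hfT using hTcomp
  have hS : ∀ Z, Z ∈ openCl S ↔ ∃ s w, W s = some w ∧ IsPrefixOf w Z := by
    intro Z
    rw [hSW]
    constructor
    · rintro ⟨w, ⟨s, hs⟩, hw⟩
      exact ⟨s, w, hs, hw⟩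
    · rintro ⟨s, w, hs, hw⟩
      exact ⟨w, ⟨s, hs⟩, hw⟩
  let A : Set (ℕ → Bool) :=
    (openCl S)ᶜ ∩ ⋂ m : ℕ, ⋃ i, {x | (T i)^[m + 1] x ∈ openCl S}
  have hA : MeasurableSet A := (measurableSet_openCl S).compl.inter
    (MeasurableSet.iInter fun m => MeasurableSet.iUnion fun i =>
      (hTmeas i).iterate _ (measurableSet_openCl S))
  have hA0 : μ A = 0 := by
    by_contra hne
    obtain ⟨n, hn, hpos⟩ := DensityHJ.exists_pos_measure_iterate μ T
      (fun i => ⟨hTmeas i, Measure.ext fun s hs => by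
        rw [Measure.map_apply (hTmeas i) hs, hTpres i s hs]⟩) hTcomm hA
      (pos_iff_ne_zero.mpr hne)
    obtain ⟨x, hx, hxT⟩ := nonempty_of_measure_ne_zero hpos.ne'
    obtain ⟨m, rfl⟩ : ∃ m, n = m + 1 := ⟨n - 1, by omega⟩
    obtain ⟨i, hi⟩ := Set.mem_iUnion.mp (Set.mem_iInter.mp hx.2 m)
    exact (hxT i).1 hi
  have hU := uniformlyCE_return hW hfc
  have hnull : μ (⋂ m, openCl {σ | (∀ j < m + 1, ∀ w, W j = some w →
      w.length ≤ σ.length ∧ ¬ w <+: σ) ∧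
      ∃ i s w, W s = some w ∧ w <+: (f i)^[m + 1] σ}) = 0 := by
    refine measure_mono_null (fun Z hZ => ?_) hA0
    rw [Set.mem_iInter] at hZ
    refine ⟨fun hmem => ?_, Set.mem_iInter.mpr fun m => Set.mem_iUnion.mpr ?_⟩
    · obtain ⟨s, w, hs, hw⟩ := (hS Z).mp hmem
      obtain ⟨σ, ⟨h1, -⟩, hσ⟩ := hZ s
      obtain ⟨hlen, hnot⟩ := h1 s (Nat.lt_succ_self s) w hs
      exact hnot (hw.prefix_of_length_le hσ hlen)
    · obtain ⟨σ, ⟨-, i, s, w, hs, hw⟩, hσ⟩ := hZ m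
      exact ⟨i, (hS _).mpr ⟨s, w, hs,
        (isPrefixOf_iterate (hfm i) (hfT i) hσ (m + 1)).of_prefix hw⟩⟩
  obtain ⟨m, hm⟩ := hz _ ⟨hU, hnull⟩
  refine ⟨m + 1, by omega, Set.mem_iInter.mpr fun i hi => hm ?_⟩
  obtain ⟨s, w, hs, hw⟩ := (hS _).mp hi
  obtain ⟨N₀, hN₀⟩ := exists_le_length_iterate (hfm i) (hfT i) z (m + 1) w.length
  let L : ℕ := ∑ j ∈ Finset.range (m + 1), ((W j).getD []).length
  refine ⟨prefixList z (max N₀ L), ⟨fun j hj v hv => ⟨?_, fun hp => ?_⟩, i, s, w, hs, ?_⟩,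
    isPrefixOf_prefixList z _⟩
  · rw [length_prefixList]
    refine le_trans ?_ (le_max_right _ _)
    have := Finset.single_le_sum (f := fun j => ((W j).getD []).length)
      (fun _ _ => Nat.zero_le _) (Finset.mem_range.mpr hj)
    simpa [hv] using this
  · exact hzP ((hS z).mpr ⟨j, v, hv, (isPrefixOf_prefixList z _).of_prefix hp⟩)
  · exact hw.prefix_of_length_le
      (isPrefixOf_iterate (hfm i) (hfT i) (isPrefixOf_prefixList z _) (m + 1))
      (hN₀ _ (le_max_left _ _))
end
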